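/- Equipartition theorem in ℝ³: for every centrally symmetric convex body K in ℝ³ there exist three planes H₁, H₂, H₃ passing through the origin such that (i) the three planes split K into 8 pieces of equal volume, and (ii) for each i = 1, 2, 3, the section K ∩ H_i is split by the other two planes into 4 parts of equal (2-dimensional) area. -/

import Mathlib

open MeasureTheory Filter
open scoped InnerProductSpace Pointwise NNReal ENNReal Topology

noncomputable section

/-- A convex body: a compact convex set with nonempty interior. -/
structure IsConvexBody {n : ℕ} (K : Set (EuclideanSpace ℝ (Fin n))) : Prop where
  convex : Convex ℝ K
  isCompact : IsCompact K
  nonempty_interior : (interior K).Nonempty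

/-- The (closed) octant determined by the sign pattern `ε` with respect to the three planes
through the origin with normals `u 0, u 1, u 2`. -/
def octant (u : Fin 3 → EuclideanSpace ℝ (Fin 3)) (ε : Fin 3 → Bool) :
    Set (EuclideanSpace ℝ (Fin 3)) :=
  {x | ∀ i, if ε i then 0 ≤ ⟪u i, x⟫_ℝ else ⟪u i, x⟫_ℝ ≤ 0}

/-! ### A discrete cup product on grids -/

/-- The increment of the argument from `z` to `w`, in `(-π, π]`. -/
def argInc (z w : ℂ) : ℝ := Complex.arg (w / z)

lemma argInc_smul_smul {c : ℂ} (hc : c ≠ 0) (z w : ℂ) :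
    argInc (c * z) (c * w) = argInc z w := by
  simp [argInc, mul_div_mul_left _ _ hc]

/-- The labels `a` are constant on the square, or the values `z` at its four corners lie in a
common open half-plane. -/
def GoodSq (a00 a10 a01 a11 : ℤ) (z00 z10 z01 z11 : ℂ) : Prop :=
  (a10 = a00 ∧ a01 = a00 ∧ a11 = a00) ∨
    ∃ z : ℂ, 0 < (z00 / z).re ∧ 0 < (z10 / z).re ∧ 0 < (z01 / z).re ∧ 0 < (z11 / z).re

/-- The cup product of the coboundary of `a` with the argument increments of `z`, evaluated on a
square. -/
def cupSq (a00 a10 a01 : ℤ) (z10 z01 z11 : ℂ) : ℝ :=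
  (a10 - a00) * argInc z10 z11 - (a01 - a00) * argInc z01 z11

lemma ne_zero_of_re_div_pos {z w : ℂ} (h : 0 < (w / z).re) : w ≠ 0 ∧ z ≠ 0 := by
  constructor <;> rintro rfl <;> simp at h

lemma argInc_eq_sub {z v w : ℂ} (hv : 0 < (v / z).re) (hw : 0 < (w / z).re) :
    argInc v w = Complex.arg (w / z) - Complex.arg (v / z) := by
  obtain ⟨hv0, hz⟩ := ne_zero_of_re_div_pos hv
  obtain ⟨hw0, -⟩ := ne_zero_of_re_div_pos hw
  have h1 := abs_lt.1 (Complex.abs_arg_lt_pi_div_two_iff.2 (Or.inl hv))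
  have h2 := abs_lt.1 (Complex.abs_arg_lt_pi_div_two_iff.2 (Or.inl hw))
  have h3 : ((Complex.arg (w / v) : ℝ) : Real.Angle) =
      ((Complex.arg (w / z) - Complex.arg (v / z) : ℝ) : Real.Angle) := by
    rw [Real.Angle.coe_sub, ← Complex.arg_div_coe_angle (div_ne_zero hw0 hz) (div_ne_zero hv0 hz)]
    congr 2
    field_simp
  have h4 := congrArg Real.Angle.toReal h3
  rw [Real.Angle.toReal_coe_eq_self_iff.2 ⟨Complex.neg_pi_lt_arg _, Complex.arg_le_pi _⟩,
    Real.Angle.toReal_coe_eq_self_iff.2 ⟨by linarith, by linarith⟩] at h4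
  exact h4

lemma argInc_coe {v w : ℂ} (hv : v ≠ 0) (hw : w ≠ 0) :
    (argInc v w : Real.Angle) = (Complex.arg w : Real.Angle) - (Complex.arg v : Real.Angle) :=
  Complex.arg_div_coe_angle hw hv

lemma cupSq_coe {a00 a10 a01 a11 : ℤ} {z00 z10 z01 z11 : ℂ}
    (h : GoodSq a00 a10 a01 a11 z00 z10 z01 z11) :
    (cupSq a00 a10 a01 z10 z01 z11 : Real.Angle) =
      -((a10 - a00) • (z10.arg : Real.Angle) + (a11 - a10) • (z11.arg : Real.Angle)
        - (a11 - a01) • (z11.arg : Real.Angle) - (a01 - a00) • (z01.arg : Real.Angle)) := by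
  rcases h with ⟨rfl, rfl, rfl⟩ | ⟨z, h0, h1, h2, h3⟩
  · simp [cupSq]
  · have e : cupSq a00 a10 a01 z10 z01 z11 =
        (a10 - a00) • argInc z10 z11 - (a01 - a00) • argInc z01 z11 := by
      simp [cupSq, zsmul_eq_mul]
    rw [e, Real.Angle.coe_sub, Real.Angle.coe_zsmul, Real.Angle.coe_zsmul,
      argInc_coe (ne_zero_of_re_div_pos h1).1 (ne_zero_of_re_div_pos h3).1,
      argInc_coe (ne_zero_of_re_div_pos h2).1 (ne_zero_of_re_div_pos h3).1]
    module

/-- The cup product of `cupSq` on the unit squares of a planar grid. -/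
def gridCup (a : ℕ → ℕ → ℤ) (z : ℕ → ℕ → ℂ) (m n : ℕ) : ℝ :=
  cupSq (a m n) (a (m + 1) n) (a m (n + 1)) (z (m + 1) n) (z m (n + 1)) (z (m + 1) (n + 1))

/-- The unit square with lower left corner `(m, n)` of a planar grid is good. -/
def GoodAt (a : ℕ → ℕ → ℤ) (z : ℕ → ℕ → ℂ) (m n : ℕ) : Prop :=
  GoodSq (a m n) (a (m + 1) n) (a m (n + 1)) (a (m + 1) (n + 1))
    (z m n) (z (m + 1) n) (z m (n + 1)) (z (m + 1) (n + 1))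

/-- The product of the coboundary of `a` with the final argument of `z` along a path. -/
def pathCup (a : ℕ → ℤ) (z : ℕ → ℂ) (n : ℕ) : Real.Angle :=
  ∑ m ∈ Finset.range n, (a (m + 1) - a m) • ((z (m + 1)).arg : Real.Angle)

lemma angle_coe_sum {ι : Type*} (s : Finset ι) (f : ι → ℝ) :
    ((∑ i ∈ s, f i : ℝ) : Real.Angle) = ∑ i ∈ s, (f i : Real.Angle) :=
  map_sum Real.Angle.coeHom f s

lemma sum_gridCup_coe {a : ℕ → ℕ → ℤ} {z : ℕ → ℕ → ℂ} {M N : ℕ}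
    (h : ∀ m < M, ∀ n < N, GoodAt a z m n) :
    ((∑ m ∈ Finset.range M, ∑ n ∈ Finset.range N, gridCup a z m n : ℝ) : Real.Angle) =
      -(pathCup (fun m => a m 0) (fun m => z m 0) M - pathCup (fun m => a m N) (fun m => z m N) M
        + pathCup (a M) (z M) N - pathCup (a 0) (z 0) N) := by
  have key : ∀ m < M, ∀ n < N, (gridCup a z m n : Real.Angle) =
      (((a (m + 1) (n + 1) - a m (n + 1)) • ((z (m + 1) (n + 1)).arg : Real.Angle)
        - (a (m + 1) n - a m n) • ((z (m + 1) n).arg : Real.Angle))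
      - ((a (m + 1) (n + 1) - a (m + 1) n) • ((z (m + 1) (n + 1)).arg : Real.Angle)
        - (a m (n + 1) - a m n) • ((z m (n + 1)).arg : Real.Angle))) := by
    intro m hm n hn
    rw [gridCup, cupSq_coe (h m hm n hn)]
    abel
  rw [angle_coe_sum]
  simp_rw [angle_coe_sum]
  rw [Finset.sum_congr rfl fun m hm => Finset.sum_congr rfl fun n hn =>
    key m (Finset.mem_range.1 hm) n (Finset.mem_range.1 hn)]
  simp_rw [Finset.sum_sub_distrib (f := fun n => _ - _)]
  rw [Finset.sum_sub_distrib]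
  have e1 : ∀ m, ∑ n ∈ Finset.range N,
      ((a (m + 1) (n + 1) - a m (n + 1)) • ((z (m + 1) (n + 1)).arg : Real.Angle)
        - (a (m + 1) n - a m n) • ((z (m + 1) n).arg : Real.Angle)) =
      (a (m + 1) N - a m N) • ((z (m + 1) N).arg : Real.Angle)
        - (a (m + 1) 0 - a m 0) • ((z (m + 1) 0).arg : Real.Angle) := fun m =>
    Finset.sum_range_sub
      (fun n => (a (m + 1) n - a m n) • ((z (m + 1) n).arg : Real.Angle)) N
  have e2 : ∑ m ∈ Finset.range M, ∑ n ∈ Finset.range N,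
      ((a (m + 1) (n + 1) - a (m + 1) n) • ((z (m + 1) (n + 1)).arg : Real.Angle)
        - (a m (n + 1) - a m n) • ((z m (n + 1)).arg : Real.Angle)) =
      pathCup (a M) (z M) N - pathCup (a 0) (z 0) N := by
    rw [← Finset.sum_range_sub (fun m => pathCup (a m) (z m) N) M]
    exact Finset.sum_congr rfl fun m _ => Finset.sum_sub_distrib _ _
  rw [e2]
  simp_rw [e1, Finset.sum_sub_distrib]
  simp only [pathCup]
  abel

/-- The labels `a` are constant on the cube with corner `(i, j, k)`, or the values of `z` at its
corners lie in a common open half-plane. -/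
def GoodCube (a : ℕ → ℕ → ℕ → ℤ) (z : ℕ → ℕ → ℕ → ℂ) (i j k : ℕ) : Prop :=
  (∃ c, ∀ i' j' k', i ≤ i' → i' ≤ i + 1 → j ≤ j' → j' ≤ j + 1 → k ≤ k' → k' ≤ k + 1 →
    a i' j' k' = c) ∨
  ∃ w, ∀ i' j' k', i ≤ i' → i' ≤ i + 1 → j ≤ j' → j' ≤ j + 1 → k ≤ k' → k' ≤ k + 1 →
    0 < (z i' j' k' / w).re

lemma GoodCube.goodAt_fst {a : ℕ → ℕ → ℕ → ℤ} {z : ℕ → ℕ → ℕ → ℂ} {i j k : ℕ}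
    (h : GoodCube a z i j k) {i' : ℕ} (h1 : i ≤ i') (h2 : i' ≤ i + 1) :
    GoodAt (a i') (z i') j k := by
  rcases h with ⟨c, h⟩ | ⟨w, h⟩
  · refine Or.inl ⟨?_, ?_, ?_⟩ <;>
      (rw [h _ _ _ h1 h2 (by omega) (by omega) (by omega) (by omega),
        h _ _ _ h1 h2 (by omega) (by omega) (by omega) (by omega)])
  · refine Or.inr ⟨w, ?_, ?_, ?_, ?_⟩ <;>
      exact h _ _ _ h1 h2 (by omega) (by omega) (by omega) (by omega)

lemma GoodCube.goodAt_trd {a : ℕ → ℕ → ℕ → ℤ} {z : ℕ → ℕ → ℕ → ℂ} {i j k : ℕ}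
    (h : GoodCube a z i j k) :
    GoodAt (fun i j => a i j k) (fun i j => z i j k) i j := by
  rcases h with ⟨c, h⟩ | ⟨w, h⟩
  · refine Or.inl ⟨?_, ?_, ?_⟩ <;>
      (dsimp only; rw [h _ _ _ (by omega) (by omega) (by omega) (by omega) (by omega) (by omega),
        h i j k (by omega) (by omega) (by omega) (by omega) (by omega) (by omega)])
  · refine Or.inr ⟨w, ?_, ?_, ?_, ?_⟩ <;>
      exact h _ _ _ (by omega) (by omega) (by omega) (by omega) (by omega) (by omega)

lemma GoodCube.coboundary {a : ℕ → ℕ → ℕ → ℤ} {z : ℕ → ℕ → ℕ → ℂ} {i j k : ℕ}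
    (h : GoodCube a z i j k) :
    gridCup (a (i + 1)) (z (i + 1)) j k - gridCup (a i) (z i) j k =
      (gridCup (fun i k => a i (j + 1) k) (fun i k => z i (j + 1) k) i k
        - gridCup (fun i k => a i j k) (fun i k => z i j k) i k)
      - (gridCup (fun i j => a i j (k + 1)) (fun i j => z i j (k + 1)) i j
        - gridCup (fun i j => a i j k) (fun i j => z i j k) i j) := by
  simp only [gridCup, cupSq]
  rcases h with ⟨c, h⟩ | ⟨w, h⟩
  · have h' : ∀ i' j' k', i ≤ i' ∧ i' ≤ i + 1 ∧ j ≤ j' ∧ j' ≤ j + 1 ∧ k ≤ k' ∧ k' ≤ k + 1 →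
        a i' j' k' = c := fun i' j' k' ⟨h1, h2, h3, h4, h5, h6⟩ => h _ _ _ h1 h2 h3 h4 h5 h6
    rw [h' i j k (by omega), h' (i + 1) j k (by omega), h' i (j + 1) k (by omega),
      h' i j (k + 1) (by omega), h' (i + 1) (j + 1) k (by omega), h' (i + 1) j (k + 1) (by omega),
      h' i (j + 1) (k + 1) (by omega)]
    ring
  · have h' : ∀ i' j' k', i ≤ i' ∧ i' ≤ i + 1 ∧ j ≤ j' ∧ j' ≤ j + 1 ∧ k ≤ k' ∧ k' ≤ k + 1 →
        0 < (z i' j' k' / w).re :=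
      fun i' j' k' ⟨h1, h2, h3, h4, h5, h6⟩ => h _ _ _ h1 h2 h3 h4 h5 h6
    have h000 := h' i j k (by omega)
    have h100 := h' (i + 1) j k (by omega)
    have h010 := h' i (j + 1) k (by omega)
    have h001 := h' i j (k + 1) (by omega)
    have h110 := h' (i + 1) (j + 1) k (by omega)
    have h101 := h' (i + 1) j (k + 1) (by omega)
    have h011 := h' i (j + 1) (k + 1) (by omega)
    have h111 := h' (i + 1) (j + 1) (k + 1) (by omega)
    rw [argInc_eq_sub h110 h111, argInc_eq_sub h101 h111, argInc_eq_sub h010 h011,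
      argInc_eq_sub h001 h011, argInc_eq_sub h011 h111, argInc_eq_sub h001 h101,
      argInc_eq_sub h100 h101, argInc_eq_sub h010 h110, argInc_eq_sub h100 h110]
    ring

/-- Stokes' theorem for one layer of cubes, in the presence of a periodicity in the second variable
and a sign change between the two ends of the third one. -/
lemma layer_stokes {a : ℕ → ℕ → ℕ → ℤ} {z : ℕ → ℕ → ℕ → ℂ} {i J K : ℕ}
    (hg : ∀ j < J, ∀ k < K, GoodCube a z i j k)
    (haJ : ∀ i k, a i J k = a i 0 k) (hzJ : ∀ i k, z i J k = z i 0 k)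
    (haK : ∀ i j, a i j K = 1 - a i j 0) (hzK : ∀ i j, z i j K = -Complex.I * z i j 0) :
    ∑ j ∈ Finset.range J, ∑ k ∈ Finset.range K, gridCup (a (i + 1)) (z (i + 1)) j k =
      ∑ j ∈ Finset.range J, ∑ k ∈ Finset.range K, gridCup (a i) (z i) j k +
      2 * ∑ j ∈ Finset.range J, gridCup (fun i j => a i j 0) (fun i j => z i j 0) i j := by
  have h1 : ∑ j ∈ Finset.range J, ∑ k ∈ Finset.range K,
      (gridCup (a (i + 1)) (z (i + 1)) j k - gridCup (a i) (z i) j k) =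
      ∑ j ∈ Finset.range J, ∑ k ∈ Finset.range K,
        ((gridCup (fun i k => a i (j + 1) k) (fun i k => z i (j + 1) k) i k
        - gridCup (fun i k => a i j k) (fun i k => z i j k) i k)
      - (gridCup (fun i j => a i j (k + 1)) (fun i j => z i j (k + 1)) i j
        - gridCup (fun i j => a i j k) (fun i j => z i j k) i j)) :=
    Finset.sum_congr rfl fun j hj => Finset.sum_congr rfl fun k hk =>
      (hg j (Finset.mem_range.1 hj) k (Finset.mem_range.1 hk)).coboundary
  have h2 : ∑ j ∈ Finset.range J, ∑ k ∈ Finset.range K,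
      (gridCup (fun i k => a i (j + 1) k) (fun i k => z i (j + 1) k) i k
        - gridCup (fun i k => a i j k) (fun i k => z i j k) i k) = 0 := by
    rw [Finset.sum_comm]
    refine Finset.sum_eq_zero fun k _ => ?_
    rw [Finset.sum_range_sub
      (fun j => gridCup (fun i k => a i j k) (fun i k => z i j k) i k)]
    simp [gridCup, haJ, hzJ]
  have h3 : ∀ j, ∑ k ∈ Finset.range K,
      (gridCup (fun i j => a i j (k + 1)) (fun i j => z i j (k + 1)) i j
        - gridCup (fun i j => a i j k) (fun i j => z i j k) i j) =
      -2 * gridCup (fun i j => a i j 0) (fun i j => z i j 0) i j := by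
    intro j
    rw [Finset.sum_range_sub
      (fun k => gridCup (fun i j => a i j k) (fun i j => z i j k) i j)]
    simp only [gridCup, cupSq, haK, hzK]
    rw [argInc_smul_smul (neg_ne_zero.2 Complex.I_ne_zero),
      argInc_smul_smul (neg_ne_zero.2 Complex.I_ne_zero)]
    push_cast
    ring
  simp_rw [Finset.sum_sub_distrib (f := fun k => gridCup (a (i + 1)) (z (i + 1)) _ k)] at h1
  rw [Finset.sum_sub_distrib] at h1
  simp_rw [Finset.sum_sub_distrib (f := fun k => _ - _)] at h1
  rw [Finset.sum_sub_distrib (f := fun k => _ ), h2] at h1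
  simp_rw [h3, ← Finset.mul_sum] at h1
  linarith

lemma layer_invariant {a : ℕ → ℕ → ℕ → ℤ} {z : ℕ → ℕ → ℕ → ℂ} {i J K : ℕ} (hK : 0 < K)
    (hg : ∀ j < J, ∀ k < K, GoodCube a z i j k)
    (haJ : ∀ i k, a i J k = a i 0 k) (hzJ : ∀ i k, z i J k = z i 0 k)
    (haK : ∀ i j, a i j K = 1 - a i j 0) (hzK : ∀ i j, z i j K = -Complex.I * z i j 0) :
    (((∑ j ∈ Finset.range J, ∑ k ∈ Finset.range K,
        gridCup (a (i + 1)) (z (i + 1)) j k) / 2 : ℝ) : Real.Angle)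
      + pathCup (fun j => a (i + 1) j 0) (fun j => z (i + 1) j 0) J =
    (((∑ j ∈ Finset.range J, ∑ k ∈ Finset.range K, gridCup (a i) (z i) j k) / 2 : ℝ) : Real.Angle)
      + pathCup (fun j => a i j 0) (fun j => z i j 0) J := by
  have h := sum_gridCup_coe (a := fun m j => a (i + m) j 0) (z := fun m j => z (i + m) j 0)
    (M := 1) (N := J) (fun m hm j hj => by
      obtain rfl : m = 0 := by omega
      exact (hg j hj 0 hK).goodAt_trd)
  rw [Finset.sum_range_one] at h
  have h' : ((∑ j ∈ Finset.range J, gridCup (fun i j => a i j 0) (fun i j => z i j 0) i j : ℝ) :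
      Real.Angle) = -(pathCup (fun j => a (i + 1) j 0) (fun j => z (i + 1) j 0) J
        - pathCup (fun j => a i j 0) (fun j => z i j 0) J) := by
    refine h.trans ?_
    have e : pathCup (fun m => a (i + m) 0 0) (fun m => z (i + m) 0 0) 1 =
        pathCup (fun m => a (i + m) J 0) (fun m => z (i + m) J 0) 1 := by
      simp [haJ, hzJ]
    rw [e]
    simp only [add_zero]
    abel
  rw [layer_stokes hg haJ hzJ haK hzK, add_div, mul_div_cancel_left₀ _ (two_ne_zero' ℝ),
    Real.Angle.coe_add, h']
  abel

lemma arg_neg_I_mul {z : ℂ} (hz : z ≠ 0) :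
    ((-Complex.I * z).arg : Real.Angle) = z.arg - ((Real.pi / 2 : ℝ) : Real.Angle) := by
  rw [Complex.arg_mul_coe_angle (neg_ne_zero.2 Complex.I_ne_zero) hz, Complex.arg_neg_I, Real.Angle.coe_neg]
  abel

lemma arg_neg_I_mul_conj {z : ℂ} (hz : z ≠ 0) :
    ((-Complex.I * (starRingEnd ℂ) z).arg : Real.Angle) =
      -z.arg - ((Real.pi / 2 : ℝ) : Real.Angle) := by
  rw [arg_neg_I_mul (by simpa using hz), Complex.arg_conj_coe_angle]

lemma argInc_conj {z v w : ℂ} (hv : 0 < (v / z).re) (hw : 0 < (w / z).re) :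
    argInc (-Complex.I * (starRingEnd ℂ) v) (-Complex.I * (starRingEnd ℂ) w) = -argInc v w := by
  rw [argInc_smul_smul (neg_ne_zero.2 Complex.I_ne_zero), argInc, argInc, ← map_div₀,
    Complex.arg_conj, if_neg]
  have h := argInc_eq_sub hv hw
  have h1 := abs_lt.1 (Complex.abs_arg_lt_pi_div_two_iff.2 (Or.inl hv))
  have h2 := abs_lt.1 (Complex.abs_arg_lt_pi_div_two_iff.2 (Or.inl hw))
  rw [argInc] at h
  intro h3
  linarith

lemma argInc_symm {z v w : ℂ} (hv : 0 < (v / z).re) (hw : 0 < (w / z).re) :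
    argInc w v = -argInc v w := by
  rw [argInc_eq_sub hv hw, argInc_eq_sub hw hv]
  ring

/-- For a path turning by a quarter over each period, with alternating labels, the cup product over
four periods is a half turn. -/
lemma pathCup_quarter_turns {a : ℕ → ℤ} {z : ℕ → ℂ} {K : ℕ}
    (ha : ∀ m, a (m + K) = 1 - a m) (hz : ∀ m, z (m + K) = -Complex.I * z m)
    (hne : ∀ m, a (m + 1) ≠ a m → z (m + 1) ≠ 0) :
    pathCup a z (4 * K) = (Real.pi : Real.Angle) := by
  set f : ℕ → Real.Angle := fun m => (a (m + 1) - a m) • ((z (m + 1)).arg : Real.Angle) with hf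
  have hshift : ∀ m, f (K + m) =
      -f m + (a (m + 1) - a m) • ((Real.pi / 2 : ℝ) : Real.Angle) := by
    intro m
    simp only [hf]
    rw [show K + m + 1 = (m + 1) + K by ring, show K + m = m + K by ring, ha, ha, hz]
    by_cases h : a (m + 1) = a m
    · simp [h]
    · rw [arg_neg_I_mul (hne m h)]
      module
  have hshift2 : ∀ m, f (2 * K + m) =
      f m - (a (m + 1) - a m) • (Real.pi : Real.Angle) := by
    intro m
    have e1 : (Real.pi : Real.Angle) =
        ((Real.pi / 2 : ℝ) : Real.Angle) + ((Real.pi / 2 : ℝ) : Real.Angle) := by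
      rw [← Real.Angle.coe_add]; congr 1; ring
    rw [show 2 * K + m = K + (K + m) by ring, hshift, hshift,
      show K + m + 1 = (m + 1) + K by ring, show K + m = m + K by ring, ha, ha, e1]
    module
  have e : pathCup a z (4 * K) =
      ∑ m ∈ Finset.range K, (f m + f (K + m) + (f (2 * K + m) + f (2 * K + (K + m)))) := by
    simp only [Finset.sum_add_distrib]
    rw [← Finset.sum_range_add, ← Finset.sum_range_add (fun m => f (2 * K + m)),
      ← two_mul, ← Finset.sum_range_add, ← two_mul, ← mul_assoc]
    rfl
  rw [e]
  have e2 : ∀ m, f m + f (K + m) + (f (2 * K + m) + f (2 * K + (K + m))) =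
      (a (m + 1) - a m) • (Real.pi : Real.Angle) := by
    intro m
    have e1 : (Real.pi : Real.Angle) =
        ((Real.pi / 2 : ℝ) : Real.Angle) + ((Real.pi / 2 : ℝ) : Real.Angle) := by
      rw [← Real.Angle.coe_add]; congr 1; ring
    rw [hshift2, hshift2, hshift,
      show K + m + 1 = (m + 1) + K by ring, show K + m = m + K by ring, ha, ha, e1]
    module
  simp_rw [e2, ← Finset.sum_smul]
  rw [Finset.sum_range_sub, show K = 0 + K by ring, ha, sub_smul, sub_smul, one_smul, sub_sub,
    ← smul_add, Real.Angle.coe_pi_add_coe_pi, smul_zero, sub_zero]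

/-- On a grid with a free orientation-reversing symmetry, the invariant of `layer_invariant`
vanishes. -/
lemma reflected_slice {a : ℕ → ℕ → ℤ} {z : ℕ → ℕ → ℂ} {J K : ℕ} (hJ : 0 < J) (hK : 0 < K)
    (hg : ∀ j < J + J, ∀ k < K, GoodAt a z j k)
    (haK : ∀ j, a j K = 1 - a j 0) (hzK : ∀ j, z j K = -Complex.I * z j 0)
    (haR : ∀ j, ∀ k ≤ K, a (J + j) (K - k) = a j k)
    (hzR : ∀ j, ∀ k ≤ K, z (J + j) (K - k) = -Complex.I * (starRingEnd ℂ) (z j k)) :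
    (((∑ j ∈ Finset.range (J + J), ∑ k ∈ Finset.range K, gridCup a z j k) / 2 : ℝ) : Real.Angle)
      + pathCup (fun j => a j 0) (fun j => z j 0) (J + J) = 0 := by
  set q : ℕ → ℝ := fun j => ∑ k ∈ Finset.range K, (a j (k + 1) - a j k) * argInc (z j k) (z j (k + 1))
    with hq
  have hrefl : ∀ j < J, ∀ k < K, gridCup a z (J + j) (K - 1 - k) = gridCup a z j k +
      ((a (j + 1) (k + 1) - a (j + 1) k) * argInc (z (j + 1) k) (z (j + 1) (k + 1))
        - (a j (k + 1) - a j k) * argInc (z j k) (z j (k + 1))) := by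
    intro j hj k hk
    have e1 : K - 1 - k = K - (k + 1) := by omega
    have e2 : K - (k + 1) + 1 = K - k := by omega
    simp only [gridCup, cupSq, e1, e2, add_assoc]
    rw [haR _ _ hk, haR _ _ hk, haR _ _ hk.le, hzR _ _ hk, hzR _ _ hk.le, hzR _ _ hk.le]
    rcases hg j (by omega) k hk with ⟨h1, h2, h3⟩ | ⟨w, h00, h10, h01, h11⟩
    · rw [h1, h2, h3]; ring
    · rw [argInc_conj h11 h10, argInc_conj h00 h10, argInc_symm h10 h11,
        argInc_eq_sub h10 h11, argInc_eq_sub h00 h10, argInc_eq_sub h00 h01,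
        argInc_eq_sub h01 h11]
      ring
  have hsplit : ∑ j ∈ Finset.range (J + J), ∑ k ∈ Finset.range K, gridCup a z j k =
      2 * (∑ j ∈ Finset.range J, ∑ k ∈ Finset.range K, gridCup a z j k) + (q J - q 0) := by
    have e : ∑ j ∈ Finset.range J, ∑ k ∈ Finset.range K, gridCup a z (J + j) k =
        ∑ j ∈ Finset.range J, (∑ k ∈ Finset.range K, gridCup a z j k + (q (j + 1) - q j)) := by
      refine Finset.sum_congr rfl fun j hj => ?_
      rw [← Finset.sum_range_reflect, hq, ← Finset.sum_sub_distrib, ← Finset.sum_add_distrib]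
      exact Finset.sum_congr rfl fun k hk =>
        hrefl j (Finset.mem_range.1 hj) k (Finset.mem_range.1 hk)
    rw [Finset.sum_range_add, e, Finset.sum_add_distrib, Finset.sum_range_sub]
    ring
  have hgood0 : ∀ k < K, a 0 (k + 1) ≠ a 0 k → ∃ w, 0 < (z 0 k / w).re ∧
      0 < (z 0 (k + 1) / w).re := by
    intro k hk hne
    rcases hg 0 (by omega) k hk with ⟨h1, h2, h3⟩ | ⟨w, h00, h10, h01, h11⟩
    · exact absurd h2 hne
    · exact ⟨w, h00, h01⟩
  have hqJ : q J = -q 0 := by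
    simp only [hq]
    rw [← Finset.sum_range_reflect, ← Finset.sum_neg_distrib]
    refine Finset.sum_congr rfl fun k hk => ?_
    have hk := Finset.mem_range.1 hk
    have e1 : K - 1 - k = K - (k + 1) := by omega
    have e2 : K - (k + 1) + 1 = K - k := by omega
    rw [e1, e2]
    have hR := haR 0
    have hZ := hzR 0
    simp only [add_zero] at hR hZ
    rw [hR _ hk, hR _ hk.le, hZ _ hk, hZ _ hk.le]
    by_cases h : a 0 (k + 1) = a 0 k
    · simp [h]
    · obtain ⟨w, h0, h1⟩ := hgood0 k hk h
      rw [argInc_conj h1 h0, argInc_symm h0 h1]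
      ring
  have hne0 : ∀ j < J, a (j + 1) 0 ≠ a j 0 → z j 0 ≠ 0 ∧ z (j + 1) 0 ≠ 0 := by
    intro j hj hne
    rcases hg j (by omega) 0 hK with ⟨h1, h2, h3⟩ | ⟨w, h00, h10, h01, h11⟩
    · exact absurd h1 hne
    · exact ⟨(ne_zero_of_re_div_pos h00).1, (ne_zero_of_re_div_pos h10).1⟩
  have haJ0 : a J 0 = a 0 K := by simpa using haR 0 K le_rfl
  have hxK : pathCup (fun j => a j K) (fun j => z j K) J =
      -pathCup (fun j => a j 0) (fun j => z j 0) J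
        + (a 0 K - a 0 0) • ((Real.pi / 2 : ℝ) : Real.Angle) := by
    rw [← haJ0, ← Finset.sum_range_sub (fun j => a j 0), Finset.sum_smul, pathCup, pathCup,
      ← Finset.sum_neg_distrib, ← Finset.sum_add_distrib]
    refine Finset.sum_congr rfl fun j hj => ?_
    rw [haK, haK, hzK]
    by_cases h : a (j + 1) 0 = a j 0
    · simp [h]
    · rw [arg_neg_I_mul (hne0 j (Finset.mem_range.1 hj) h).2]
      module
  have hyJ : pathCup (a J) (z J) K = pathCup (a 0) (z 0) K - (q 0 : Real.Angle)
        + (a 0 K - a 0 0) • ((Real.pi / 2 : ℝ) : Real.Angle) := by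
    rw [← Finset.sum_range_sub (fun k => a 0 k), Finset.sum_smul, pathCup, pathCup, hq,
      angle_coe_sum, ← Finset.sum_range_reflect, ← Finset.sum_sub_distrib,
      ← Finset.sum_add_distrib]
    refine Finset.sum_congr rfl fun k hk => ?_
    have hk := Finset.mem_range.1 hk
    have e1 : K - 1 - k = K - (k + 1) := by omega
    have e2 : K - (k + 1) + 1 = K - k := by omega
    have hR := haR 0
    have hZ := hzR 0
    simp only [add_zero] at hR hZ
    rw [e1, e2, hR _ hk, hR _ hk.le, hZ _ hk.le]
    by_cases h : a 0 (k + 1) = a 0 k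
    · simp [h]
    · obtain ⟨w, h0, h1⟩ := hgood0 k hk h
      rw [← Int.cast_sub, ← zsmul_eq_mul, Real.Angle.coe_zsmul,
        argInc_coe (ne_zero_of_re_div_pos h0).1 (ne_zero_of_re_div_pos h1).1,
        arg_neg_I_mul_conj (ne_zero_of_re_div_pos h0).1]
      module
  have hC : pathCup (fun j => a j 0) (fun j => z j 0) (J + J) =
      pathCup (fun j => a j 0) (fun j => z j 0) J
        + pathCup (fun j => a j 0) (fun j => z j 0) J := by
    conv_lhs => rw [pathCup, Finset.sum_range_add]
    congr 1
    refine Finset.sum_congr rfl fun j hj => ?_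
    have hA : ∀ j, a (J + j) 0 = 1 - a j 0 := fun j => by
      rw [← haK, ← haR j K le_rfl, Nat.sub_self]
    have hZ : ∀ j, z (J + j) 0 = -Complex.I * (starRingEnd ℂ) (-Complex.I * z j 0) := fun j => by
      rw [← hzK, ← hzR j K le_rfl, Nat.sub_self]
    rw [add_assoc, hA, hA, hZ]
    by_cases h : a (j + 1) 0 = a j 0
    · simp [h]
    · have h0 := (hne0 j (Finset.mem_range.1 hj) h).2
      rw [arg_neg_I_mul_conj (mul_ne_zero (neg_ne_zero.2 Complex.I_ne_zero) h0), arg_neg_I_mul h0]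
      module
  have hhalf : (∑ j ∈ Finset.range (J + J), ∑ k ∈ Finset.range K, gridCup a z j k) / 2 =
      (∑ j ∈ Finset.range J, ∑ k ∈ Finset.range K, gridCup a z j k) - q 0 := by
    rw [hsplit, hqJ]; ring
  rw [hhalf, Real.Angle.coe_sub,
    sum_gridCup_coe (fun j hj k hk => hg j (by omega) k hk), hxK, hyJ, hC]
  abel

/-- A labelled grid modelled on the product of an interval and a torus cannot be good everywhere. -/
theorem not_all_goodCube {a : ℕ → ℕ → ℕ → ℤ} {z : ℕ → ℕ → ℕ → ℂ} {K : ℕ} (hK : 0 < K)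
    (hg : ∀ i < K, ∀ j < 4 * K, ∀ k < K, GoodCube a z i j k)
    (haJ : ∀ i k, a i (4 * K) k = a i 0 k) (hzJ : ∀ i k, z i (4 * K) k = z i 0 k)
    (haK : ∀ i j, a i j K = 1 - a i j 0) (hzK : ∀ i j, z i j K = -Complex.I * z i j 0)
    (haR : ∀ j, ∀ k ≤ K, a K (2 * K + j) (K - k) = a K j k)
    (hzR : ∀ j, ∀ k ≤ K, z K (2 * K + j) (K - k) = -Complex.I * (starRingEnd ℂ) (z K j k))
    (ha0 : ∀ j k, a 0 j k = a 0 (j + k) 0) (hz0 : ∀ j k, z 0 j k = z 0 (j + k) 0) : False := by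
  have hinv : ∀ i ≤ K,
      (((∑ j ∈ Finset.range (4 * K), ∑ k ∈ Finset.range K, gridCup (a i) (z i) j k) / 2 : ℝ) :
        Real.Angle) + pathCup (fun j => a i j 0) (fun j => z i j 0) (4 * K) =
      (((∑ j ∈ Finset.range (4 * K), ∑ k ∈ Finset.range K, gridCup (a 0) (z 0) j k) / 2 : ℝ) :
        Real.Angle) + pathCup (fun j => a 0 j 0) (fun j => z 0 j 0) (4 * K) := by
    intro i
    induction i with
    | zero => exact fun _ => rfl
    | succ i ih =>
      intro hi
      rw [layer_invariant hK (hg i hi) haJ hzJ haK hzK, ih (by omega)]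
  have h1 := hinv K le_rfl
  have h4 : 4 * K = 2 * K + 2 * K := by ring
  rw [h4, reflected_slice (by omega) hK (fun j hj k hk =>
    (hg (K - 1) (by omega) j (by omega) k hk).goodAt_fst (by omega) (by omega)) (haK K) (hzK K)
    haR hzR, ← h4] at h1
  have h2 : ∀ j k, gridCup (a 0) (z 0) j k = 0 := by
    intro j k
    simp only [gridCup, cupSq]
    rw [ha0 j (k + 1), ha0 j k, ha0 (j + 1) k, hz0 (j + 1) k, hz0 j (k + 1), hz0 (j + 1) (k + 1),
      show j + 1 + k = j + (k + 1) by ring]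
    ring
  have haS : ∀ m, a 0 (m + K) 0 = 1 - a 0 m 0 := fun m => by rw [← ha0, haK]
  have hzS : ∀ m, z 0 (m + K) 0 = -Complex.I * z 0 m 0 := fun m => by rw [← hz0, hzK]
  have hne : ∀ m, a 0 (m + 1) 0 ≠ a 0 m 0 → z 0 (m + 1) 0 ≠ 0 := by
    intro m
    induction m using Nat.strong_induction_on with
    | _ m ih =>
      intro h
      rcases lt_or_ge m K with hm | hm
      · rcases (hg 0 hK m (by omega) 0 hK).goodAt_fst le_rfl (by omega) with
          ⟨h1, -, -⟩ | ⟨w, -, h10, -⟩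
        · exact absurd h1 h
        · exact (ne_zero_of_re_div_pos h10).1
      · obtain ⟨m, rfl⟩ := Nat.exists_eq_add_of_le' hm
        rw [show m + K + 1 = m + 1 + K by ring, haS, haS] at h
        rw [show m + K + 1 = m + 1 + K by ring, hzS]
        exact mul_ne_zero (neg_ne_zero.2 Complex.I_ne_zero) (ih m (by omega) fun h' => h (by rw [h']))
  rw [pathCup_quarter_turns haS hzS hne] at h1
  simp only [h2, Finset.sum_const_zero, zero_div, Real.Angle.coe_zero, zero_add] at h1
  exact Real.Angle.pi_ne_zero h1.symm

/-- The sign of a real number as a label in `{0, 1}`, with a prescribed value at `0`. -/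
def signLabel (x : ℝ) (tie : ℤ) : ℤ := if 0 < x then 1 else if x < 0 then 0 else tie

lemma signLabel_neg (x : ℝ) (t : ℤ) : signLabel (-x) (1 - t) = 1 - signLabel x t := by
  unfold signLabel
  rcases lt_trichotomy x 0 with h | rfl | h
  · simp [h, h.not_gt]
  · simp
  · simp [h, h.not_gt]

/-- The label of a grid point at which the function to be labelled vanishes. -/
def tieLabel (K i j k : ℕ) : ℤ :=
  if i = 0 then (if (j + k) / K % 2 = 0 then 1 else 0)
  else if k = 0 then (if j / (2 * K) % 2 = 0 then 1 else 0)
  else if k = K then (if j / (2 * K) % 2 = 0 then 0 else 1)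
  else 1

/-- A common zero theorem for a real and a complex function on the product of an interval and a
plane with prescribed symmetries. -/
theorem exists_common_zero {A : ℝ → ℝ → ℝ → ℝ} {B : ℝ → ℝ → ℝ → ℂ}
    (hA : Continuous fun p : ℝ × ℝ × ℝ => A p.1 p.2.1 p.2.2)
    (hB : Continuous fun p : ℝ × ℝ × ℝ => B p.1 p.2.1 p.2.2)
    (hAp : ∀ r φ s, A r (φ + 4) s = A r φ s) (hBp : ∀ r φ s, B r (φ + 4) s = B r φ s)
    (hAs : ∀ r φ s, A r φ (s + 1) = -A r φ s)
    (hBs : ∀ r φ s, B r φ (s + 1) = -Complex.I * B r φ s)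
    (hAr : ∀ φ s, A 1 (φ + 2) (1 - s) = A 1 φ s)
    (hBr : ∀ φ s, B 1 (φ + 2) (1 - s) = -Complex.I * (starRingEnd ℂ) (B 1 φ s))
    (hA0 : ∀ φ s, A 0 φ s = A 0 (φ + s) 0) (hB0 : ∀ φ s, B 0 φ s = B 0 (φ + s) 0) :
    ∃ r φ s, A r φ s = 0 ∧ B r φ s = 0 := by
  by_contra! hne
  set F : ℝ × ℝ × ℝ → ℝ × ℂ := fun p => (A p.1 p.2.1 p.2.2, B p.1 p.2.1 p.2.2) with hF
  have hFc : Continuous F := hA.prodMk hB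
  set S : Set (ℝ × ℝ × ℝ) := Set.Icc (0, 0, 0) (1, 5, 1)
  have hS : IsCompact S := isCompact_Icc
  obtain ⟨p₀, -, hp₀⟩ := hS.exists_isMinOn (f := fun p => ‖F p‖)
    ⟨(0, 0, 0), ⟨le_rfl, by simp [Prod.le_def]⟩⟩ hFc.norm.continuousOn
  obtain ⟨ε, hε⟩ : ∃ ε, ε = ‖F p₀‖ := ⟨_, rfl⟩
  have hε0 : 0 < ε := by
    rw [hε, norm_pos_iff]
    intro h
    exact hne _ _ _ (congrArg Prod.fst h) (congrArg Prod.snd h)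
  have hmin : ∀ p ∈ S, ε ≤ ‖F p‖ := fun p hp => hε ▸ hp₀ hp
  obtain ⟨δ, hδ, hδF⟩ := Metric.uniformContinuousOn_iff.1
    (hS.uniformContinuousOn_of_continuous hFc.continuousOn) (ε / 2) (by positivity)
  obtain ⟨n, hn⟩ := exists_nat_one_div_lt hδ
  obtain ⟨K, hK⟩ : ∃ K, K = n + 1 := ⟨_, rfl⟩
  have hK0 : 0 < K := by omega
  have hKr : (0 : ℝ) < K := by exact_mod_cast hK0
  have hKδ : 1 / (K : ℝ) < δ := by rw [hK]; exact_mod_cast hn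
  set a : ℕ → ℕ → ℕ → ℤ := fun i j k => signLabel (A (i / K) (j / K) (k / K)) (tieLabel K i j k)
    with ha
  set z : ℕ → ℕ → ℕ → ℂ := fun i j k => B (i / K) (j / K) (k / K) with hz
  have hKK : (K : ℝ) / K = 1 := div_self hKr.ne'
  have hdiv : ∀ i : ℕ, (i + K) / K = i / K + 1 := fun i => Nat.add_div_right i hK0
  have hdiv' : ∀ i : ℕ, (2 * K + i) / (2 * K) = i / (2 * K) + 1 := fun i => by
    rw [add_comm, Nat.add_div_right i (by omega)]
  refine not_all_goodCube (a := a) (z := z) hK0 ?_ ?_ ?_ ?_ ?_ ?_ ?_ ?_ ?_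
  · intro i hi j hj k hk
    set p : ℕ → ℕ → ℕ → ℝ × ℝ × ℝ := fun i j k => ((i : ℝ) / K, (j : ℝ) / K, (k : ℝ) / K) with hp
    have hmem : ∀ i' j' k', i ≤ i' → i' ≤ i + 1 → j ≤ j' → j' ≤ j + 1 → k ≤ k' → k' ≤ k + 1 →
        p i' j' k' ∈ S := by
      intro i' j' k' h1 h2 h3 h4 h5 h6
      have e1 : (i' : ℝ) ≤ K := by exact_mod_cast (by omega : i' ≤ K)
      have e2 : (j' : ℝ) ≤ 5 * K := by exact_mod_cast (by omega : j' ≤ 5 * K)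
      have e3 : (k' : ℝ) ≤ K := by exact_mod_cast (by omega : k' ≤ K)
      refine ⟨⟨?_, ?_, ?_⟩, ⟨?_, ?_, ?_⟩⟩ <;> simp only [hp]
      · positivity
      · positivity
      · positivity
      · rwa [div_le_one hKr]
      · rwa [div_le_iff₀ hKr]
      · rwa [div_le_one hKr]
    have hdist : ∀ i' j' k', i ≤ i' → i' ≤ i + 1 → j ≤ j' → j' ≤ j + 1 → k ≤ k' → k' ≤ k + 1 →
        dist (F (p i' j' k')) (F (p i j k)) < ε / 2 := by
      intro i' j' k' h1 h2 h3 h4 h5 h6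
      refine hδF _ (hmem _ _ _ h1 h2 h3 h4 h5 h6) _
        (hmem _ _ _ (by omega) (by omega) (by omega) (by omega) (by omega) (by omega))
        (lt_of_le_of_lt ?_ hKδ)
      have hstep : ∀ m m' : ℕ, m ≤ m' → m' ≤ m + 1 → dist ((m' : ℝ) / K) ((m : ℝ) / K) ≤ 1 / K := by
        intro m m' h h'
        have h : (m : ℝ) ≤ m' := by exact_mod_cast h
        have h' : (m' : ℝ) ≤ m + 1 := by exact_mod_cast h'
        rw [Real.dist_eq, ← sub_div, abs_div, abs_of_pos hKr, abs_of_nonneg (by linarith)]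
        gcongr
        linarith
      exact max_le (hstep _ _ h1 h2) (max_le (hstep _ _ h3 h4) (hstep _ _ h5 h6))
    have h0 := hmin _ (hmem i j k (by omega) (by omega) (by omega) (by omega) (by omega) (by omega))
    rcases le_max_iff.1 h0 with h0 | h0
    · left
      refine ⟨if 0 < A (i / K) (j / K) (k / K) then 1 else 0, ?_⟩
      intro i' j' k' h1 h2 h3 h4 h5 h6
      have h := (le_max_left _ _).trans_lt (hdist i' j' k' h1 h2 h3 h4 h5 h6)
      simp only [hF, hp, Real.dist_eq, Real.norm_eq_abs] at h h0
      rw [abs_lt] at h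
      simp only [ha, signLabel]
      rcases le_abs.1 h0 with h0 | h0
      · rw [if_pos (by linarith), if_pos (by linarith)]
      · rw [if_neg (by linarith), if_pos (by linarith), if_neg (by linarith)]
    · right
      refine ⟨z i j k, ?_⟩
      intro i' j' k' h1 h2 h3 h4 h5 h6
      have h := (le_max_right _ _).trans_lt (hdist i' j' k' h1 h2 h3 h4 h5 h6)
      have hB' : ε ≤ ‖z i j k‖ := h0
      have h : ‖z i' j' k' - z i j k‖ < ε / 2 := by rw [← dist_eq_norm]; exact h
      have hz0 : z i j k ≠ 0 := norm_pos_iff.1 (by linarith)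
      have e : z i' j' k' / z i j k = 1 + (z i' j' k' - z i j k) / z i j k := by
        field_simp
        ring
      have h7 : ‖(z i' j' k' - z i j k) / z i j k‖ < 1 := by
        rw [norm_div, div_lt_one (by linarith)]
        linarith
      have h8 := (Complex.abs_re_le_norm _).trans_lt h7
      rw [e, Complex.add_re, Complex.one_re]
      linarith [(abs_lt.1 h8).1]
  · intro i k
    simp only [ha]
    congr 1
    · rw [← hAp _ ((0 : ℕ) / (K : ℝ))]
      congr 1
      push_cast
      field_simp
      ring
    · have e : (4 * K + k) / K = k / K + 4 := by
        rw [add_comm, Nat.add_mul_div_right _ _ hK0]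
      have e' : 4 * K / (2 * K) = 2 := Nat.div_eq_of_eq_mul_left (by omega) (by ring)
      simp only [tieLabel, e, e', zero_add, Nat.zero_div]
      split_ifs <;> omega
  · intro i k
    simp only [hz]
    rw [← hBp _ ((0 : ℕ) / (K : ℝ))]
    congr 1
    push_cast
    field_simp
    ring
  · intro i j
    simp only [ha]
    rw [← signLabel_neg, ← hAs]
    congr 1
    · simp [hKK]
    · simp only [tieLabel, hdiv, add_zero, hK0.ne', if_true, if_false]
      split_ifs <;> omega
  · intro i j
    simp only [hz]
    rw [← hBs]
    simp [hKK]
  · intro j k hk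
    simp only [ha, hKK]
    congr 1
    · rw [← hAr (j / K) (k / K), Nat.cast_sub hk]
      congr 1
      · push_cast
        field_simp
        ring
      · field_simp
    · simp only [tieLabel, hdiv', hK0.ne', if_false]
      split_ifs <;> omega
  · intro j k hk
    simp only [hz, hKK]
    rw [← hBr (j / K) (k / K), Nat.cast_sub hk]
    congr 1
    · push_cast
      field_simp
      ring
    · field_simp
  · intro j k
    simp only [ha]
    congr 1
    · simp only [Nat.cast_zero, zero_div]
      rw [hA0]
      push_cast
      rw [add_div]
  · intro j k
    simp only [hz, Nat.cast_zero, zero_div]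
    rw [hB0]
    push_cast
    rw [add_div]

/-! ### The sign function -/

/-- The sign of a real number, as a real number. -/
def sg (x : ℝ) : ℝ := (SignType.sign x : ℝ)

lemma sg_mul (x y : ℝ) : sg (x * y) = sg x * sg y := by simp [sg, sign_mul]

lemma sg_neg (x : ℝ) : sg (-x) = -sg x := by simp [sg, Left.sign_neg]

lemma sg_zero : sg 0 = 0 := by simp [sg]

lemma sg_of_pos {x : ℝ} (h : 0 < x) : sg x = 1 := by simp [sg, sign_pos h]

lemma sg_of_neg {x : ℝ} (h : x < 0) : sg x = -1 := by simp [sg, sign_neg h]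

lemma sg_smul {c : ℝ} (hc : 0 < c) (x : ℝ) : sg (c * x) = sg x := by
  rw [sg_mul, sg_of_pos hc, one_mul]

lemma abs_sg_le (x : ℝ) : |sg x| ≤ 1 := by
  rcases lt_trichotomy x 0 with h | rfl | h
  · simp [sg_of_neg h]
  · simp [sg_zero]
  · simp [sg_of_pos h]

lemma sg_mono : Monotone sg := by
  intro x y h
  rcases lt_trichotomy x 0 with h1 | rfl | h1
  · rw [sg_of_neg h1]
    exact (abs_le.1 (abs_sg_le y)).1
  · rcases h.eq_or_lt with rfl | h
    · rfl
    · simp [sg_zero, sg_of_pos h]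
  · rw [sg_of_pos h1, sg_of_pos (h1.trans_le h)]

lemma measurable_sg : Measurable sg := sg_mono.measurable

lemma continuousAt_sg {x : ℝ} (h : x ≠ 0) : ContinuousAt sg x :=
  (continuous_of_discreteTopology (f := fun s : SignType => (s : ℝ))).continuousAt.comp
    (continuousAt_sign_of_ne_zero h)

/-! ### Symmetric convex bodies -/

/-- Three-dimensional Euclidean space. -/
abbrev E3 : Type := EuclideanSpace ℝ (Fin 3)

/-- A centrally symmetric convex body in three-dimensional space. -/
structure SymBody (K : Set E3) : Prop where
  body : IsConvexBody K
  neg_mem : ∀ x ∈ K, -x ∈ K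

namespace SymBody

variable {K : Set E3} (hK : SymBody K)

include hK

lemma zero_mem_interior : (0 : E3) ∈ interior K := by
  obtain ⟨x, hx⟩ := hK.body.nonempty_interior
  have h := hK.body.convex.combo_interior_self_mem_interior hx
    (hK.neg_mem x (interior_subset hx)) (a := 1 / 2) (b := 1 / 2)
    (by norm_num) (by norm_num) (by norm_num)
  simpa using h

lemma isClosed : IsClosed K := hK.body.isCompact.isClosed

lemma measurableSet : MeasurableSet K := hK.isClosed.measurableSet

lemma smul_mem_interior {x : E3} {t : ℝ} (ht : 1 < t) (h : t • x ∈ K) : x ∈ interior K := by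
  have h0 : 0 < t := by linarith
  have h1 := hK.body.convex.combo_interior_self_mem_interior hK.zero_mem_interior h
    (a := 1 - t⁻¹) (b := t⁻¹) (by rw [sub_pos]; exact inv_lt_one_of_one_lt₀ ht)
    (by positivity) (by ring)
  simpa [smul_smul, inv_mul_cancel₀ h0.ne'] using h1

lemma volume_lt_top : volume K < ∞ := hK.body.isCompact.measure_lt_top

lemma volume_pos : 0 < (volume K).toReal := by
  refine ENNReal.toReal_pos ?_ hK.volume_lt_top.ne
  exact (Measure.measure_pos_of_nonempty_interior volume hK.body.nonempty_interior).ne'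

end SymBody

/-- The parametrization of the plane spanned by two vectors. -/
def planeMap (a b : E3) (q : ℝ × ℝ) : E3 := q.1 • a + q.2 • b

lemma continuous_planeMap (a b : E3) : Continuous (planeMap a b) := by
  unfold planeMap
  fun_prop

/-- The plane section of `K` by the span of `a` and `b`, in coordinates. -/
def planeSec (K : Set E3) (a b : E3) : Set (ℝ × ℝ) := planeMap a b ⁻¹' K

/-- Two vectors of space are linearly independent. -/
def LI (a b : E3) : Prop := LinearIndependent ℝ ![a, b]

lemma LI.planeMap_norm_ge {a b : E3} (h : LI a b) :
    ∃ c > 0, ∀ q, c * ‖q‖ ≤ ‖planeMap a b q‖ := by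
  set L : ℝ × ℝ →ₗ[ℝ] E3 := (LinearMap.fst ℝ ℝ ℝ).smulRight a + (LinearMap.snd ℝ ℝ ℝ).smulRight b
  have hL : ∀ q, L q = planeMap a b q := fun q => by simp [L, planeMap]
  have hker : LinearMap.ker L = ⊥ := by
    rw [LinearMap.ker_eq_bot']
    intro q hq
    rw [hL] at hq
    obtain ⟨h1, h2⟩ := LinearIndependent.pair_iff.1 h q.1 q.2 hq
    exact Prod.ext h1 h2
  obtain ⟨C, hC, hL'⟩ := L.exists_antilipschitzWith hker
  refine ⟨(C : ℝ)⁻¹, by positivity, fun q => ?_⟩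
  have := hL'.le_mul_dist q 0
  rw [map_zero, dist_zero_right, dist_zero_right, hL] at this
  rwa [inv_mul_le_iff₀ (by positivity)]

lemma LI.eventually_norm_ge {a b : E3} (h : LI a b) :
    ∃ c > 0, ∀ᶠ ab : E3 × E3 in 𝓝 (a, b), ∀ q, c * ‖q‖ ≤ ‖planeMap ab.1 ab.2 q‖ := by
  obtain ⟨c, hc, h⟩ := h.planeMap_norm_ge
  refine ⟨c / 2, by positivity, ?_⟩
  filter_upwards [Metric.ball_mem_nhds (a, b) (show 0 < c / 4 by positivity)] with ab hab q
  have h1 : ‖ab.1 - a‖ < c / 4 := by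
    rw [← dist_eq_norm]; exact (le_max_left _ _).trans_lt hab
  have h2 : ‖ab.2 - b‖ < c / 4 := by
    rw [← dist_eq_norm]; exact (le_max_right _ _).trans_lt hab
  have e : planeMap a b q = planeMap ab.1 ab.2 q - planeMap (ab.1 - a) (ab.2 - b) q := by
    simp only [planeMap]; module
  have h3 : ‖planeMap (ab.1 - a) (ab.2 - b) q‖ ≤ c / 2 * ‖q‖ := by
    refine (norm_add_le _ _).trans ?_
    rw [norm_smul, norm_smul]
    have := norm_fst_le q
    have := norm_snd_le q
    calc _ ≤ ‖q‖ * (c / 4) + ‖q‖ * (c / 4) := by gcongr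
      _ = _ := by ring
  have h4 := h q
  rw [e] at h4
  have h5 := h4.trans (norm_sub_le _ _)
  linarith

lemma isClosed_planeSec {K : Set E3} (hK : SymBody K) (a b : E3) : IsClosed (planeSec K a b) :=
  hK.isClosed.preimage (continuous_planeMap a b)

lemma zero_mem_interior_planeSec {K : Set E3} (hK : SymBody K) (a b : E3) :
    0 ∈ interior (planeSec K a b) := by
  refine mem_interior.2 ⟨planeMap a b ⁻¹' interior K, Set.preimage_mono interior_subset,
    isOpen_interior.preimage (continuous_planeMap a b), ?_⟩
  simpa [planeMap] using hK.zero_mem_interior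

lemma SymBody.exists_bound {K : Set E3} (hK : SymBody K) : ∃ R > 0, ∀ x ∈ K, ‖x‖ ≤ R :=
  hK.body.isCompact.isBounded.exists_pos_norm_le

lemma ae_interior_or_notMem {K : Set E3} (hK : SymBody K) (a b : E3) :
    ∀ᵐ q : ℝ × ℝ, planeMap a b q ∈ interior K ∨ planeMap a b q ∉ K := by
  have hconv : Convex ℝ (planeSec K a b) := by
    set L : ℝ × ℝ →ₗ[ℝ] E3 := (LinearMap.fst ℝ ℝ ℝ).smulRight a + (LinearMap.snd ℝ ℝ ℝ).smulRight b
    have hL : planeSec K a b = L ⁻¹' K := by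
      ext q; simp [L, planeMap, planeSec]
    rw [hL]
    exact hK.body.convex.linear_preimage L
  have h0 := hconv.addHaar_frontier (volume : Measure (ℝ × ℝ))
  filter_upwards [compl_mem_ae_iff.2 h0] with q hq
  by_contra! hcon
  refine hq ⟨subset_closure hcon.2, fun hint => hcon.1 ?_⟩
  have h1 : Tendsto (fun t : ℝ => t • q) (𝓝[>] 1) (𝓝 q) := by
    have : Continuous fun t : ℝ => t • q := by fun_prop
    simpa using (this.tendsto 1).mono_left nhdsWithin_le_nhds
  obtain ⟨t, ht, ht1⟩ := ((h1.eventually (isOpen_interior.mem_nhds hint)).and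
    self_mem_nhdsWithin).exists
  refine hK.smul_mem_interior ht1 ?_
  have := interior_subset ht
  simpa [planeSec, planeMap, smul_smul] using this

/-- The signed area of the plane section of `K` by the span of `a` and `b`: quadrants bounded by
the two lines count with alternating signs, in coordinates. -/
def secSign (K : Set E3) (a b : E3) : ℝ :=
  ∫ q : ℝ × ℝ, (planeSec K a b).indicator (fun q => sg (q.1 * q.2)) q

lemma measurable_sg_mul : Measurable fun q : ℝ × ℝ => sg (q.1 * q.2) :=
  measurable_sg.comp (measurable_fst.mul measurable_snd)

lemma norm_indicator_sg_le {α : Type*} (S : Set α) (g : α → ℝ) (q : α) :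
    ‖S.indicator (fun q => sg (g q)) q‖ ≤ S.indicator (fun _ => (1 : ℝ)) q := by
  by_cases h : q ∈ S
  · simpa [h] using abs_sg_le _
  · simp [h]

lemma ae_ne_zero_prod : ∀ᵐ q : ℝ × ℝ, q.1 ≠ 0 ∧ q.2 ≠ 0 := by
  have h0 : ∀ᵐ x : ℝ, x ≠ 0 := by simp [ae_iff]
  exact (Measure.quasiMeasurePreserving_fst.ae h0).and (Measure.quasiMeasurePreserving_snd.ae h0)

lemma continuousAt_secSign {K : Set E3} (hK : SymBody K) {a b : E3} (h : LI a b) :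
    ContinuousAt (fun ab : E3 × E3 => secSign K ab.1 ab.2) (a, b) := by
  obtain ⟨c, hc, hev⟩ := h.eventually_norm_ge
  obtain ⟨R, hR, hKR⟩ := hK.exists_bound
  refine continuousAt_of_dominated
    (bound := (Metric.closedBall (0 : ℝ × ℝ) (R / c)).indicator (fun _ => 1)) ?_ ?_ ?_ ?_
  · exact .of_forall fun ab => (measurable_sg_mul.indicator
      (isClosed_planeSec hK _ _).measurableSet).aestronglyMeasurable
  · filter_upwards [hev] with ab hab
    refine .of_forall fun q => (norm_indicator_sg_le _ _ _).trans
      (Set.indicator_le_indicator_of_subset ?_ (fun _ => zero_le_one) q)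
    intro q hq
    rw [mem_closedBall_zero_iff, le_div_iff₀ hc, mul_comm]
    exact (hab q).trans (hKR _ hq)
  · exact (integrable_indicator_iff measurableSet_closedBall).2
      (integrableOn_const (isCompact_closedBall _ _).measure_lt_top.ne)
  · filter_upwards [ae_interior_or_notMem hK a b] with q hq
    have hcont : Continuous fun ab : E3 × E3 => planeMap ab.1 ab.2 q := by
      unfold planeMap; fun_prop
    rcases hq with hq | hq
    · have : ∀ᶠ ab : E3 × E3 in 𝓝 (a, b), q ∈ planeSec K ab.1 ab.2 := by
        filter_upwards [hcont.continuousAt (isOpen_interior.mem_nhds hq)] with ab hab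
        exact interior_subset (s := K) hab
      refine (continuousAt_const (y := sg (q.1 * q.2))).congr ?_
      filter_upwards [this] with ab hab
      simp [hab]
    · have : ∀ᶠ ab : E3 × E3 in 𝓝 (a, b), q ∉ planeSec K ab.1 ab.2 :=
        (hK.isClosed.isOpen_compl.preimage hcont).mem_nhds (x := (a, b)) hq
      refine (continuousAt_const (y := (0 : ℝ))).congr ?_
      filter_upwards [this] with ab hab
      simp [hab]

lemma li_iff {a b : E3} : LI a b ↔ ∀ s t : ℝ, s • a + t • b = 0 → s = 0 ∧ t = 0 :=
  LinearIndependent.pair_iff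

lemma LI.symm {a b : E3} (h : LI a b) : LI b a := by
  rw [li_iff] at h ⊢
  intro s t hst
  exact (h t s (by rwa [add_comm])).symm

lemma LI.shear {a b : E3} (h : LI a b) (c : ℝ) : LI (c • b + a) b := by
  rw [li_iff] at h ⊢
  intro s t hst
  obtain ⟨rfl, h2⟩ := h s (s * c + t) (by rw [← hst]; module)
  simpa using h2

lemma integral_comp_measurePreserving {T : ℝ × ℝ → ℝ × ℝ}
    (hT : MeasurePreserving T volume volume) {F : ℝ × ℝ → ℝ} (hF : Measurable F) :
    ∫ q, F (T q) = ∫ q, F q := by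
  conv_rhs => rw [← hT.map_eq]
  exact (integral_map hT.measurable.aemeasurable hF.aestronglyMeasurable).symm

section

variable {K : Set E3} (hK : SymBody K)

include hK

lemma measurable_planeSec_indicator (a b : E3) {g : ℝ × ℝ → ℝ} (hg : Measurable g) :
    Measurable fun q => (planeSec K a b).indicator (fun q => sg (g q)) q :=
  (measurable_sg.comp hg).indicator (isClosed_planeSec hK _ _).measurableSet

lemma secSign_comm (a b : E3) : secSign K a b = secSign K b a := by
  refine .trans ?_ (integral_comp_measurePreserving Measure.measurePreserving_swap
    (measurable_planeSec_indicator hK b a (measurable_fst.mul measurable_snd)))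
  refine integral_congr_ae (.of_forall fun q => ?_)
  have : q ∈ planeSec K a b ↔ q.swap ∈ planeSec K b a := by
    simp [planeSec, planeMap, add_comm]
  by_cases hq : q ∈ planeSec K a b
  · have hq' := this.1 hq
    simp [hq, hq', mul_comm]
  · have hq' := (not_congr this).1 hq
    simp [hq, hq']

lemma secSign_neg_left (a b : E3) : secSign K (-a) b = -secSign K a b := by
  have hT : MeasurePreserving (fun q : ℝ × ℝ => (-q.1, q.2)) volume volume :=
    (Measure.measurePreserving_neg volume).prod (.id volume)
  refine .trans ?_ (congrArg Neg.neg (integral_comp_measurePreserving hT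
    (measurable_planeSec_indicator hK a b (measurable_fst.mul measurable_snd))))
  rw [← integral_neg]
  refine integral_congr_ae (.of_forall fun q => ?_)
  have : q ∈ planeSec K (-a) b ↔ (-q.1, q.2) ∈ planeSec K a b := by
    simp [planeSec, planeMap]
  by_cases hq : q ∈ planeSec K (-a) b
  · have hq' := this.1 hq
    simp [hq, hq', sg_neg]
  · have hq' := (not_congr this).1 hq
    simp [hq, hq']

lemma secSign_neg_right (a b : E3) : secSign K a (-b) = -secSign K a b := by
  rw [secSign_comm hK, secSign_neg_left hK, secSign_comm hK]

lemma secSign_shear (n P : E3) (c : ℝ) : secSign K (c • n + P) n =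
    ∫ q : ℝ × ℝ, (planeSec K P n).indicator (fun q => sg (q.1 * (q.2 - c * q.1))) q := by
  have hT : MeasurePreserving (fun q : ℝ × ℝ => (q.1, c * q.1 + q.2)) volume volume :=
    (MeasurePreserving.id volume).skew_product (g := fun x y => c * x + y) (by fun_prop)
      (.of_forall fun x => (measurePreserving_add_left volume (c * x)).map_eq)
  refine .trans ?_ (integral_comp_measurePreserving hT
    (measurable_planeSec_indicator hK P n (g := fun q => q.1 * (q.2 - c * q.1)) (by fun_prop)))
  refine integral_congr_ae (.of_forall fun q => ?_)
  have : q ∈ planeSec K (c • n + P) n ↔ (q.1, c * q.1 + q.2) ∈ planeSec K P n := by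
    simp only [planeSec, planeMap, Set.mem_preimage]
    rw [show q.1 • (c • n + P) + q.2 • n = q.1 • P + (c * q.1 + q.2) • n by module]
  by_cases hq : q ∈ planeSec K (c • n + P) n
  · have hq' := this.1 hq
    simp [hq, hq']
  · have hq' := (not_congr this).1 hq
    simp [hq, hq']

lemma volume_planeSec_lt_top {a b : E3} (h : LI a b) : volume (planeSec K a b) < ∞ := by
  obtain ⟨c, hc, h⟩ := h.planeMap_norm_ge
  obtain ⟨R, hR, hKR⟩ := hK.exists_bound
  refine (measure_mono (t := Metric.closedBall 0 (R / c)) fun q hq => ?_).trans_lt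
    (isCompact_closedBall _ _).measure_lt_top
  rw [mem_closedBall_zero_iff, le_div_iff₀ hc, mul_comm]
  exact (h q).trans (hKR _ hq)

lemma volume_planeSec_pos {a b : E3} (h : LI a b) : 0 < (volume (planeSec K a b)).toReal :=
  ENNReal.toReal_pos (Measure.measure_pos_of_nonempty_interior volume
    ⟨_, zero_mem_interior_planeSec hK a b⟩).ne' (volume_planeSec_lt_top hK h).ne

lemma integrable_planeSec_indicator {a b : E3} (h : LI a b) {g : ℝ × ℝ → ℝ} (hg : Measurable g) :
    Integrable fun q => (planeSec K a b).indicator (fun q => sg (g q)) q :=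
  ((integrable_indicator_iff (isClosed_planeSec hK _ _).measurableSet).2
    (integrableOn_const (C := (1 : ℝ)) (volume_planeSec_lt_top hK h).ne)).mono'
    (measurable_planeSec_indicator hK a b hg).aestronglyMeasurable
    (.of_forall fun q => norm_indicator_sg_le _ _ _)

lemma strictAnti_secSign {n P : E3} (h : LI P n) :
    StrictAnti fun c : ℝ => secSign K (c • n + P) n := by
  intro c c' hc
  simp only [secSign_shear hK]
  rw [← sub_pos, ← integral_sub (integrable_planeSec_indicator hK h (by fun_prop))
    (integrable_planeSec_indicator hK h (by fun_prop))]
  have hle : ∀ q : ℝ × ℝ, q.1 * (q.2 - c' * q.1) ≤ q.1 * (q.2 - c * q.1) := fun q => by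
    nlinarith [mul_nonneg (sub_nonneg.2 hc.le) (mul_self_nonneg q.1)]
  refine (integral_pos_iff_support_of_nonneg ?_ ((integrable_planeSec_indicator hK h
    (by fun_prop)).sub (integrable_planeSec_indicator hK h (by fun_prop)))).2 ?_
  · intro q
    by_cases hq : q ∈ planeSec K P n
    · simpa [hq] using sg_mono (hle q)
    · simp [hq]
  · set U : Set (ℝ × ℝ) := interior (planeSec K P n) ∩
      ({q | 0 < q.1 * (q.2 - c * q.1)} ∩ {q | q.1 * (q.2 - c' * q.1) < 0}) with hU
    have hUo : IsOpen U := isOpen_interior.inter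
      ((isOpen_lt (by fun_prop) (by fun_prop)).inter (isOpen_lt (by fun_prop) (by fun_prop)))
    have hUn : U.Nonempty := by
      have h1 : Tendsto (fun t : ℝ => (t, t * ((c + c') / 2))) (𝓝[>] 0) (𝓝 (0 : ℝ × ℝ)) := by
        have : Continuous fun t : ℝ => (t, t * ((c + c') / 2)) := by fun_prop
        have h2 := (this.tendsto 0).mono_left (nhdsWithin_le_nhds (s := Set.Ioi 0))
        simpa [Prod.zero_eq_mk] using h2
      obtain ⟨t, ht, ht0⟩ := ((h1.eventually (isOpen_interior.mem_nhds
        (zero_mem_interior_planeSec hK P n))).and self_mem_nhdsWithin).exists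
      replace ht0 : 0 < t := ht0
      refine ⟨_, ht, ?_, ?_⟩
      · have : 0 < t * t * ((c' - c) / 2) := mul_pos (mul_pos ht0 ht0) (by linarith)
        simp only [Set.mem_ofPred_eq]
        linarith
      · have : 0 < t * t * ((c' - c) / 2) := mul_pos (mul_pos ht0 ht0) (by linarith)
        simp only [Set.mem_ofPred_eq]
        linarith
    refine (hUo.measure_pos volume hUn).trans_le (measure_mono fun q hq => ?_)
    have hq1 : q ∈ planeSec K P n := interior_subset hq.1
    have h2 : 0 < q.1 * (q.2 - c * q.1) := hq.2.1
    have h3 : q.1 * (q.2 - c' * q.1) < 0 := hq.2.2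
    simp [hq1, sg_of_pos h2, sg_of_neg h3]

lemma exists_secSign_eq_zero {n P : E3} (h : LI P n) : ∃ c : ℝ, secSign K (c • n + P) n = 0 := by
  have hcont : Continuous fun c : ℝ => secSign K (c • n + P) n := by
    refine continuous_iff_continuousAt.2 fun c => ?_
    have h1 : Continuous fun c : ℝ => (c • n + P, n) := by fun_prop
    exact ContinuousAt.comp (f := fun c : ℝ => (c • n + P, n)) (continuousAt_secSign hK (h.shear c))
      h1.continuousAt
  have hlim : ∀ (l : Filter ℝ) [l.IsCountablyGenerated] (σ : ℝ),
      (∀ q : ℝ × ℝ, q.1 ≠ 0 → ∀ᶠ c in l, sg (q.1 * (q.2 - c * q.1)) = σ) →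
      Tendsto (fun c => secSign K (c • n + P) n) l (𝓝 (σ * (volume (planeSec K P n)).toReal)) := by
    intro l _ σ hl
    have e : σ * (volume (planeSec K P n)).toReal =
        ∫ q, (planeSec K P n).indicator (fun _ => σ) q := by
      rw [integral_indicator_const _ (isClosed_planeSec hK _ _).measurableSet, smul_eq_mul,
        mul_comm]
      rfl
    rw [e]
    simp only [secSign_shear hK]
    refine tendsto_integral_filter_of_dominated_convergence
      ((planeSec K P n).indicator fun _ => 1) ?_ ?_ ?_ ?_
    · exact .of_forall fun c => (integrable_planeSec_indicator hK h
        (by fun_prop)).aestronglyMeasurable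
    · exact .of_forall fun c => .of_forall fun q => norm_indicator_sg_le _ _ _
    · exact (integrable_indicator_iff (isClosed_planeSec hK _ _).measurableSet).2
        (integrableOn_const (volume_planeSec_lt_top hK h).ne)
    · filter_upwards [ae_ne_zero_prod] with q hq
      refine tendsto_const_nhds.congr' ?_
      filter_upwards [hl q hq.1] with c hc
      simp [Set.indicator, hc]
  have hpos := volume_planeSec_pos hK h
  refine mem_range_of_exists_le_of_exists_ge hcont ?_ ?_
  · have h1 := hlim atTop (-1) fun q hq => by
      filter_upwards [eventually_gt_atTop (q.2 / q.1)] with c hc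
      refine sg_of_neg ?_
      have h2 : 0 < q.1 * q.1 := mul_self_pos.2 hq
      have h3 : q.1 * (q.2 - c * q.1) = q.1 * q.1 * (q.2 / q.1 - c) := by field_simp
      rw [h3]
      exact mul_neg_of_pos_of_neg h2 (by linarith)
    obtain ⟨c, hc⟩ := (h1.eventually_lt_const (show _ < (0 : ℝ) by linarith)).exists
    exact ⟨c, hc.le⟩
  · have h1 := hlim atBot 1 fun q hq => by
      filter_upwards [eventually_lt_atBot (q.2 / q.1)] with c hc
      refine sg_of_pos ?_
      have h2 : 0 < q.1 * q.1 := mul_self_pos.2 hq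
      have h3 : q.1 * (q.2 - c * q.1) = q.1 * q.1 * (q.2 / q.1 - c) := by field_simp
      rw [h3]
      exact mul_pos h2 (by linarith)
    obtain ⟨c, hc⟩ := (h1.eventually_const_lt (show (0 : ℝ) < _ by linarith)).exists
    exact ⟨c, hc.le⟩

end

/-- The root of a strictly monotone function depends continuously on parameters. -/
lemma continuousAt_root {X : Type*} [TopologicalSpace X] {G : X → ℝ → ℝ} {c : X → ℝ} {x₀ : X}
    (hG : ∀ t, ContinuousAt (fun x => G x t) x₀) (hm : ∀ᶠ x in 𝓝 x₀, StrictMono (G x))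
    (hc : ∀ᶠ x in 𝓝 x₀, G x (c x) = 0) : ContinuousAt c x₀ := by
  have h0 := hm.self_of_nhds
  have h1 := hc.self_of_nhds
  refine tendsto_order.2 ⟨fun l hl => ?_, fun l hl => ?_⟩
  · have h2 := (hG l).eventually_lt_const (show G x₀ l < 0 from h1 ▸ h0 hl)
    filter_upwards [h2, hm, hc] with x h3 h4 h5
    exact h4.lt_iff_lt.1 (by rwa [h5])
  · have h2 := (hG l).eventually_const_lt (show 0 < G x₀ l from h1 ▸ h0 hl)
    filter_upwards [h2, hm, hc] with x h3 h4 h5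
    exact h4.lt_iff_lt.1 (by rwa [h5])

lemma LI.eventually {a b : E3} (h : LI a b) : ∀ᶠ ab : E3 × E3 in 𝓝 (a, b), LI ab.1 ab.2 := by
  obtain ⟨c, hc, h⟩ := h.eventually_norm_ge
  filter_upwards [h] with ab hab
  rw [li_iff]
  intro s t hst
  have h1 := hab (s, t)
  rw [planeMap, hst, norm_zero] at h1
  have h2 : ‖(s, t)‖ = 0 := le_antisymm (nonpos_of_mul_nonpos_right h1 hc) (norm_nonneg _)
  rw [norm_eq_zero] at h2
  exact ⟨congrArg Prod.fst h2, congrArg Prod.snd h2⟩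

lemma LI.neg_left {a b : E3} (h : LI a b) : LI (-a) b := by
  rw [li_iff] at h ⊢
  intro s t hst
  have := h (-s) t (by rw [← hst]; module)
  simpa using this

/-- The slope `c` for which the lines spanned by `n` and `c • n + P` split the plane section of `K`
into quadrants of equal area. -/
def secSlope (K : Set E3) (n P : E3) : ℝ :=
  open Classical in if h : ∃ c : ℝ, secSign K (c • n + P) n = 0 then h.choose else 0

section

variable {K : Set E3} (hK : SymBody K)

include hK

lemma secSign_secSlope {n P : E3} (h : LI P n) : secSign K (secSlope K n P • n + P) n = 0 := by
  have h1 := exists_secSign_eq_zero hK h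
  rw [secSlope, dif_pos h1]
  exact h1.choose_spec

lemma secSlope_eq {n P : E3} (h : LI P n) {c : ℝ} (hc : secSign K (c • n + P) n = 0) :
    secSlope K n P = c :=
  (strictAnti_secSign hK h).injective ((secSign_secSlope hK h).trans hc.symm)

lemma secSlope_neg_right {n P : E3} (h : LI P n) : secSlope K n (-P) = -secSlope K n P := by
  refine secSlope_eq hK h.neg_left ?_
  rw [show -secSlope K n P • n + -P = -(secSlope K n P • n + P) by module, secSign_neg_left hK,
    secSign_secSlope hK h, neg_zero]

lemma secSlope_neg_left {n P : E3} (h : LI P n) : secSlope K (-n) P = -secSlope K n P := by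
  refine secSlope_eq hK h.symm.neg_left.symm ?_
  rw [show -secSlope K n P • -n + P = secSlope K n P • n + P by module, secSign_neg_right hK,
    secSign_secSlope hK h, neg_zero]

lemma continuousAt_secSlope {n P : E3} (h : LI P n) :
    ContinuousAt (fun v : E3 × E3 => secSlope K v.1 v.2) (n, P) := by
  have hev : ∀ᶠ v : E3 × E3 in 𝓝 (n, P), LI v.2 v.1 := by
    have h1 : Continuous fun v : E3 × E3 => (v.2, v.1) := by fun_prop
    exact (h1.tendsto (n, P)).eventually h.eventually
  refine continuousAt_root (G := fun v c => -secSign K (c • v.1 + v.2) v.1) ?_ ?_ ?_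
  · intro c
    have h1 : Continuous fun v : E3 × E3 => (c • v.1 + v.2, v.1) := by fun_prop
    exact (ContinuousAt.comp (f := fun v : E3 × E3 => (c • v.1 + v.2, v.1)) (x := (n, P))
      (continuousAt_secSign hK (h.shear c)) h1.continuousAt).neg
  · filter_upwards [hev] with v hv
    exact (strictAnti_secSign hK hv).neg
  · filter_upwards [hev] with v hv
    rw [secSign_secSlope hK hv, neg_zero]

end

lemma ae_inner_ne_zero {u : E3} (hu : u ≠ 0) : ∀ᵐ x : E3, ⟪u, x⟫_ℝ ≠ 0 := by
  have h := Measure.addHaar_submodule (volume : Measure E3) (LinearMap.ker (innerₛₗ ℝ u)) (by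
    intro h
    rw [LinearMap.ker_eq_top] at h
    have := LinearMap.congr_fun h u
    simp [hu] at this)
  filter_upwards [compl_mem_ae_iff.2 h] with x hx h0
  exact hx (by simpa using h0)

/-- The signed volume of `K`, where the regions bounded by the planes with normals `u` and `v` count
with alternating signs. -/
def volSign (K : Set E3) (u v : E3) : ℝ := ∫ x in K, sg (⟪u, x⟫_ℝ * ⟪v, x⟫_ℝ)

lemma volSign_comm (K : Set E3) (u v : E3) : volSign K u v = volSign K v u := by
  simp only [volSign, mul_comm]

lemma volSign_neg_left (K : Set E3) (u v : E3) : volSign K (-u) v = -volSign K u v := by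
  simp only [volSign, inner_neg_left, neg_mul, sg_neg, integral_neg]

lemma volSign_neg_right (K : Set E3) (u v : E3) : volSign K u (-v) = -volSign K u v := by
  rw [volSign_comm, volSign_neg_left, volSign_comm]

lemma continuousAt_volSign {K : Set E3} (hK : SymBody K) {u v : E3} (hu : u ≠ 0) (hv : v ≠ 0) :
    ContinuousAt (fun w : E3 × E3 => volSign K w.1 w.2) (u, v) := by
  refine continuousAt_of_dominated (bound := fun _ => 1) ?_ ?_ ?_ ?_
  · exact .of_forall fun w => (measurable_sg.comp (by fun_prop)).aestronglyMeasurable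
  · exact .of_forall fun w => .of_forall fun x => abs_sg_le _
  · exact integrableOn_const hK.volume_lt_top.ne
  · filter_upwards [ae_restrict_of_ae (ae_inner_ne_zero hu),
      ae_restrict_of_ae (ae_inner_ne_zero hv)] with x h1 h2
    have h3 : Continuous fun w : E3 × E3 => ⟪w.1, x⟫_ℝ * ⟪w.2, x⟫_ℝ := by fun_prop
    exact ContinuousAt.comp (f := fun w : E3 × E3 => ⟪w.1, x⟫_ℝ * ⟪w.2, x⟫_ℝ) (x := (u, v))
      (continuousAt_sg (mul_ne_zero h1 h2)) h3.continuousAt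

/-! ### Counting half turns -/

/-- The number of half turns between the line through `z` and the line with angle `t`, counted from
the one with angle `0`. -/
def turns (t : ℝ) (z : ℂ) : ℤ := ⌊(t - z.arg) / Real.pi⌋ - ⌊(-z.arg) / Real.pi⌋

/-- The imaginary part of `z` after a rotation by the angle `-t`. -/
def rotIm (t : ℝ) (z : ℂ) : ℝ := -Real.sin t * z.re + Real.cos t * z.im

lemma rotIm_eq (t : ℝ) (z : ℂ) : rotIm t z = -(‖z‖ * Real.sin (t - z.arg)) := by
  rw [rotIm, Real.sin_sub]
  have h1 := Complex.norm_mul_cos_arg z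
  have h2 := Complex.norm_mul_sin_arg z
  linear_combination (Real.sin t) * h1 - (Real.cos t) * h2

lemma turns_mono {t t' : ℝ} (h : t ≤ t') (z : ℂ) : turns t z ≤ turns t' z := by
  unfold turns
  gcongr

lemma turns_add_pi (t : ℝ) (z : ℂ) : turns (t + Real.pi) z = turns t z + 1 := by
  have : (t + Real.pi - z.arg) / Real.pi = (t - z.arg) / Real.pi + 1 := by
    field_simp
    ring
  rw [turns, turns, this, Int.floor_add_one]
  ring

lemma turns_zero (z : ℂ) : turns 0 z = 0 := by simp [turns]

lemma abs_turns_le (t : ℝ) (z : ℂ) : |(turns t z : ℝ)| ≤ |t| / Real.pi + 1 := by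
  have h1 := Int.floor_le ((t - z.arg) / Real.pi)
  have h2 := Int.lt_floor_add_one ((t - z.arg) / Real.pi)
  have h3 := Int.floor_le ((-z.arg) / Real.pi)
  have h4 := Int.lt_floor_add_one ((-z.arg) / Real.pi)
  have h5 : (t - z.arg) / Real.pi - (-z.arg) / Real.pi = t / Real.pi := by ring
  have h6 : |t| / Real.pi = |t / Real.pi| := by rw [abs_div, abs_of_pos Real.pi_pos]
  rw [h6]
  have h7 := neg_abs_le (t / Real.pi)
  have h8 := le_abs_self (t / Real.pi)
  rw [abs_le]
  simp only [turns]
  push_cast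
  constructor <;> linarith

lemma measurable_turns (t : ℝ) : Measurable (turns t) := by
  unfold turns
  exact (Int.measurable_floor.comp (by fun_prop)).sub (Int.measurable_floor.comp (by fun_prop))

lemma turns_eq {t θ : ℝ} {z : ℂ} (h : (z.arg : Real.Angle) = θ) :
    turns t z = ⌊(t - θ) / Real.pi⌋ - ⌊(-θ) / Real.pi⌋ := by
  obtain ⟨k, hk⟩ := Real.Angle.angle_eq_iff_two_pi_dvd_sub.1 h
  have e : z.arg = θ + 2 * Real.pi * k := by linarith
  have h1 : (t - z.arg) / Real.pi = (t - θ) / Real.pi - ((2 * k : ℤ) : ℝ) := by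
    rw [e]; push_cast; field_simp; ring
  have h2 : (-z.arg) / Real.pi = (-θ) / Real.pi - ((2 * k : ℤ) : ℝ) := by
    rw [e]; push_cast; field_simp; ring
  rw [turns, h1, h2, Int.floor_sub_intCast, Int.floor_sub_intCast]
  ring

lemma turns_rot {z : ℂ} (hz : z ≠ 0) (φ t : ℝ) :
    turns t (Complex.exp (-(φ * Complex.I)) * z) = turns (φ + t) z - turns φ z := by
  have h : ((Complex.exp (-(φ * Complex.I)) * z).arg : Real.Angle) = ((z.arg - φ : ℝ) : Real.Angle) := by
    rw [Complex.arg_mul_coe_angle (Complex.exp_ne_zero _) hz]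
    have : -(φ * Complex.I) = ((-φ : ℝ) : ℂ) * Complex.I := by push_cast; ring
    rw [this, Complex.arg_exp_mul_I]
    simp only [Real.Angle.coe_toIocMod, Real.Angle.coe_sub, Real.Angle.coe_neg]
    abel
  rw [turns_eq h, turns, turns]
  have e1 : t - (z.arg - φ) = φ + t - z.arg := by ring
  have e2 : -(z.arg - φ) = φ - z.arg := by ring
  rw [e1, e2]
  ring

lemma not_int_of_rotIm_ne_zero {t : ℝ} {z : ℂ} (h : rotIm t z ≠ 0) (m : ℤ) :
    (t - z.arg) / Real.pi ≠ m := by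
  intro h1
  rw [div_eq_iff Real.pi_ne_zero] at h1
  rw [rotIm_eq, h1, Real.sin_int_mul_pi] at h
  simp at h

lemma floor_neg_of_ne_int {x : ℝ} (h : ∀ m : ℤ, x ≠ m) : ⌊-x⌋ = -⌊x⌋ - 1 := by
  rw [Int.floor_eq_iff]
  have h1 := Int.floor_le x
  have h2 := Int.lt_floor_add_one x
  have h3 := lt_of_le_of_ne h1 (h _).symm
  push_cast
  constructor <;> linarith

lemma turns_conj {z : ℂ} {t : ℝ} (h0 : rotIm 0 z ≠ 0) (ht : rotIm t z ≠ 0) :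
    turns (-t) ((starRingEnd ℂ) z) = -turns t z := by
  rw [turns_eq (θ := -z.arg) (by rw [Complex.arg_conj_coe_angle, Real.Angle.coe_neg]), turns]
  have e1 : (-t - -z.arg) / Real.pi = -((t - z.arg) / Real.pi) := by ring
  have e2 : - -z.arg / Real.pi = -((0 - z.arg) / Real.pi) := by ring
  rw [e1, e2, floor_neg_of_ne_int (not_int_of_rotIm_ne_zero ht),
    floor_neg_of_ne_int (not_int_of_rotIm_ne_zero h0), zero_sub]
  ring

lemma sg_sin (y : ℝ) (h : Real.sin y ≠ 0) : sg (Real.sin y) = (-1) ^ ⌊y / Real.pi⌋ := by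
  obtain ⟨k, hk⟩ : ∃ k, k = ⌊y / Real.pi⌋ := ⟨_, rfl⟩
  rw [← hk]
  have h1 : (k : ℝ) * Real.pi ≤ y := by
    rw [← le_div_iff₀ Real.pi_pos, hk]; exact Int.floor_le _
  have h2 : y < (k + 1 : ℝ) * Real.pi := by
    rw [← div_lt_iff₀ Real.pi_pos, hk]; exact Int.lt_floor_add_one _
  have h3 : Real.sin y = (-1) ^ k * Real.sin (y - k * Real.pi) := by
    rw [← Real.sin_add_int_mul_pi, sub_add_cancel]
  have h4 : 0 ≤ Real.sin (y - k * Real.pi) :=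
    Real.sin_nonneg_of_nonneg_of_le_pi (by linarith) (by linarith)
  have h5 : 0 < Real.sin (y - k * Real.pi) :=
    h4.lt_of_ne fun h6 => h (by rw [h3, ← h6, mul_zero])
  rw [h3, mul_comm, sg_smul h5]
  rcases Int.even_or_odd k with hk | hk
  · rw [hk.neg_one_zpow, sg_of_pos one_pos]
  · rw [hk.neg_one_zpow, sg_of_neg (by norm_num)]

lemma sg_rotIm_mul {t t' : ℝ} {z : ℂ} (h1 : t ≤ t') (h2 : t' ≤ t + Real.pi)
    (ht : rotIm t z ≠ 0) (ht' : rotIm t' z ≠ 0) :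
    sg (rotIm t z * rotIm t' z) = 1 - 2 * ((turns t' z : ℝ) - turns t z) := by
  have h3 := turns_mono h1 z
  have h4 := turns_mono h2 z
  rw [turns_add_pi] at h4
  rw [rotIm_eq] at ht ht'
  have hz : 0 < ‖z‖ := (norm_nonneg z).lt_of_ne fun h => ht (by simp [← h])
  have hs : Real.sin (t - z.arg) ≠ 0 := fun h => ht (by simp [h])
  have hs' : Real.sin (t' - z.arg) ≠ 0 := fun h => ht' (by simp [h])
  rw [rotIm_eq, rotIm_eq, neg_mul_neg, mul_mul_mul_comm, sg_smul (mul_pos hz hz), sg_mul,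
    sg_sin _ hs, sg_sin _ hs']
  obtain ⟨d, hd⟩ : ∃ d, d = turns t' z - turns t z := ⟨_, rfl⟩
  have e : ⌊(t' - z.arg) / Real.pi⌋ = ⌊(t - z.arg) / Real.pi⌋ + d := by
    rw [hd, turns, turns]; ring
  have e' : ((turns t' z : ℝ) - turns t z) = d := by rw [hd]; push_cast; ring
  rw [e, e', zpow_add₀ (by norm_num), ← mul_assoc, ← mul_zpow]
  have : d = 0 ∨ d = 1 := by omega
  rcases this with rfl | rfl <;> norm_num

lemma continuousAt_floor_of_ne_int {x : ℝ} (h : ∀ m : ℤ, x ≠ m) :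
    ContinuousAt (fun y : ℝ => (⌊y⌋ : ℝ)) x := by
  refine (continuousAt_const (y := (⌊x⌋ : ℝ))).congr ?_
  have h1 := lt_of_le_of_ne (Int.floor_le x) (h _).symm
  filter_upwards [Ioo_mem_nhds h1 (Int.lt_floor_add_one x)] with y hy
  rw [Int.floor_eq_iff.2 ⟨hy.1.le, hy.2⟩]

lemma continuousAt_turns {z : ℂ} {t : ℝ} (h0 : rotIm 0 z ≠ 0) (ht : rotIm t z ≠ 0) :
    ContinuousAt (fun w : ℝ × ℂ => (turns w.1 w.2 : ℝ)) (t, z) := by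
  have hz : z ∈ Complex.slitPlane := Or.inr (by simpa [rotIm] using h0)
  have harg : ContinuousAt (fun w : ℝ × ℂ => w.2.arg) (t, z) :=
    ContinuousAt.comp (f := fun w : ℝ × ℂ => w.2) (Complex.continuousAt_arg hz)
      continuous_snd.continuousAt
  have h1 : ContinuousAt (fun w : ℝ × ℂ => (w.1 - w.2.arg) / Real.pi) (t, z) :=
    (continuous_fst.continuousAt.sub harg).div_const _
  have h2 : ContinuousAt (fun w : ℝ × ℂ => (-w.2.arg) / Real.pi) (t, z) :=
    harg.neg.div_const _
  have h0' : ∀ m : ℤ, (-z.arg) / Real.pi ≠ m := fun m => by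
    simpa using not_int_of_rotIm_ne_zero h0 m
  have := (ContinuousAt.comp (f := fun w : ℝ × ℂ => (w.1 - w.2.arg) / Real.pi) (x := (t, z))
    (continuousAt_floor_of_ne_int (not_int_of_rotIm_ne_zero ht)) h1).sub
    (ContinuousAt.comp (f := fun w : ℝ × ℂ => (-w.2.arg) / Real.pi) (x := (t, z))
    (continuousAt_floor_of_ne_int h0') h2)
  refine this.congr (.of_forall fun w => ?_)
  simp [turns]

/-- Two vectors are orthonormal. -/
structure Orth (e e' : E3) : Prop where
  left : ⟪e, e⟫_ℝ = 1
  right : ⟪e', e'⟫_ℝ = 1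
  mixed : ⟪e, e'⟫_ℝ = 0

lemma Orth.mixed' {e e' : E3} (h : Orth e e') : ⟪e', e⟫_ℝ = 0 := by
  rw [real_inner_comm, h.mixed]

/-- The unit vector at angle `t` in the plane spanned by an orthonormal pair. -/
def circ (a b : E3) (t : ℝ) : E3 := Real.cos t • a + Real.sin t • b

/-- The derivative of `circ`. -/
def circ' (a b : E3) (t : ℝ) : E3 := -Real.sin t • a + Real.cos t • b

lemma Orth.inner_circ'_circ {e e' : E3} (h : Orth e e') (s t : ℝ) :
    ⟪circ' e e' s, circ e e' t⟫_ℝ = Real.sin (t - s) := by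
  simp only [circ, circ', inner_add_left, inner_add_right, real_inner_smul_left,
    real_inner_smul_right, h.left, h.right, h.mixed, h.mixed', Real.sin_sub]
  ring

lemma Orth.inner_circ_circ {e e' : E3} (h : Orth e e') (s t : ℝ) :
    ⟪circ e e' s, circ e e' t⟫_ℝ = Real.cos (t - s) := by
  simp only [circ, inner_add_left, inner_add_right, real_inner_smul_left,
    real_inner_smul_right, h.left, h.right, h.mixed, h.mixed', Real.cos_sub]
  ring

lemma Orth.inner_circ'_circ' {e e' : E3} (h : Orth e e') (s t : ℝ) :
    ⟪circ' e e' s, circ' e e' t⟫_ℝ = Real.cos (t - s) := by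
  simp only [circ', inner_add_left, inner_add_right, real_inner_smul_left,
    real_inner_smul_right, h.left, h.right, h.mixed, h.mixed', Real.cos_sub]
  ring

lemma Orth.rotate {e e' : E3} (h : Orth e e') (φ : ℝ) : Orth (circ e e' φ) (circ' e e' φ) where
  left := by rw [h.inner_circ_circ]; simp
  right := by rw [h.inner_circ'_circ']; simp
  mixed := by rw [real_inner_comm, h.inner_circ'_circ]; simp

lemma Orth.neg_right {e e' : E3} (h : Orth e e') : Orth e (-e') where
  left := h.left
  right := by simpa using h.right
  mixed := by simpa using h.mixed

lemma Orth.circ'_ne_zero {e e' : E3} (h : Orth e e') (t : ℝ) : circ' e e' t ≠ 0 := by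
  intro h0
  have := h.inner_circ'_circ' t t
  simp [h0] at this

lemma circ_neg_right (e e' : E3) (t : ℝ) : circ e (-e') (-t) = circ e e' t := by
  simp only [circ, Real.sin_neg, Real.cos_neg]; module

lemma circ_add_pi (e e' : E3) (t : ℝ) : circ e e' (t + Real.pi) = -circ e e' t := by
  simp only [circ, Real.sin_add_pi, Real.cos_add_pi]; module

lemma circ_rotate (e e' : E3) (φ t : ℝ) :
    circ (circ e e' φ) (circ' e e' φ) t = circ e e' (φ + t) := by
  simp only [circ, circ', Real.sin_add, Real.cos_add]; module

/-- The orthogonal projection to the plane of an orthonormal pair, in complex notation. -/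
def planeCoord (e e' x : E3) : ℂ := ⟨⟪e, x⟫_ℝ, ⟪e', x⟫_ℝ⟩

lemma continuous_planeCoord : Continuous fun w : E3 × E3 × E3 => planeCoord w.1 w.2.1 w.2.2 := by
  have : (fun w : E3 × E3 × E3 => planeCoord w.1 w.2.1 w.2.2) =
      fun w => (⟪w.1, w.2.2⟫_ℝ : ℂ) + (⟪w.2.1, w.2.2⟫_ℝ : ℂ) * Complex.I := by
    ext w
    exact Complex.mk_eq_add_mul_I _ _
  rw [this]
  fun_prop

lemma rotIm_planeCoord (e e' x : E3) (t : ℝ) :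
    rotIm t (planeCoord e e' x) = ⟪circ' e e' t, x⟫_ℝ := by
  simp only [rotIm, planeCoord, circ', inner_add_left, real_inner_smul_left]

lemma planeCoord_rotate (e e' x : E3) (φ : ℝ) : planeCoord (circ e e' φ) (circ' e e' φ) x =
    Complex.exp (-(φ * Complex.I)) * planeCoord e e' x := by
  have h : -(φ * Complex.I) = ((-φ : ℝ) : ℂ) * Complex.I := by push_cast; ring
  rw [h, Complex.exp_mul_I, ← Complex.ofReal_cos, ← Complex.ofReal_sin, Real.cos_neg, Real.sin_neg]
  apply Complex.ext <;>
    simp only [planeCoord, circ, circ', inner_add_left, real_inner_smul_left, Complex.mul_re,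
      Complex.mul_im, Complex.add_re, Complex.add_im, Complex.ofReal_re, Complex.ofReal_im,
      Complex.I_re, Complex.I_im] <;>
    ring

lemma planeCoord_neg_right (e e' x : E3) :
    planeCoord e (-e') x = (starRingEnd ℂ) (planeCoord e e' x) := by
  apply Complex.ext <;> simp [planeCoord]

/-- The volume of `K` swept by a half-plane rotating about an axis, counted with multiplicity. -/
def turnVol (K : Set E3) (e e' : E3) (t : ℝ) : ℝ := ∫ x in K, (turns t (planeCoord e e' x) : ℝ)

lemma Orth.ae_rotIm_ne_zero {e e' : E3} (h : Orth e e') (K : Set E3) (t : ℝ) :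
    ∀ᵐ x ∂(volume.restrict K), rotIm t (planeCoord e e' x) ≠ 0 := by
  simp only [rotIm_planeCoord]
  exact ae_restrict_of_ae (ae_inner_ne_zero (h.circ'_ne_zero t))

lemma measurable_turns_planeCoord (e e' : E3) (t : ℝ) :
    Measurable fun x => (turns t (planeCoord e e' x) : ℝ) := by
  have h : Continuous fun x => planeCoord e e' x :=
    continuous_planeCoord.comp (f := fun x => (e, e', x)) (by fun_prop)
  exact (measurable_of_countable fun n : ℤ => (n : ℝ)).comp
    ((measurable_turns t).comp h.measurable)

lemma turnVol_zero (K : Set E3) (e e' : E3) : turnVol K e e' 0 = 0 := by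
  simp [turnVol, turns_zero]

lemma turnVol_neg (K : Set E3) {e e' : E3} (h : Orth e e') (t : ℝ) :
    turnVol K e (-e') (-t) = -turnVol K e e' t := by
  rw [turnVol, turnVol, ← integral_neg]
  refine integral_congr_ae ?_
  filter_upwards [h.ae_rotIm_ne_zero K 0, h.ae_rotIm_ne_zero K t] with x h0 ht
  rw [planeCoord_neg_right, turns_conj h0 ht]
  push_cast
  rfl

section

variable {K : Set E3} (hK : SymBody K)

include hK

lemma integrable_turns (e e' : E3) (t : ℝ) :
    Integrable (fun x => (turns t (planeCoord e e' x) : ℝ)) (volume.restrict K) :=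
  (integrableOn_const (C := |t| / Real.pi + 1) hK.volume_lt_top.ne).mono'
    (measurable_turns_planeCoord e e' t).aestronglyMeasurable
    (.of_forall fun _ => abs_turns_le _ _)

lemma turnVol_add_pi (e e' : E3) (t : ℝ) :
    turnVol K e e' (t + Real.pi) = turnVol K e e' t + (volume K).toReal := by
  simp only [turnVol, turns_add_pi]
  push_cast
  rw [integral_add (integrable_turns hK e e' t) (integrableOn_const hK.volume_lt_top.ne)]
  simp [Measure.real]

lemma turnVol_mono (e e' : E3) : Monotone (turnVol K e e') := by
  intro t t' h
  exact integral_mono (integrable_turns hK e e' t) (integrable_turns hK e e' t')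
    fun x => Int.cast_le.2 (turns_mono h (planeCoord e e' x))

lemma volSign_circ' {e e' : E3} (h : Orth e e') {t t' : ℝ} (h1 : t ≤ t') (h2 : t' ≤ t + Real.pi) :
    volSign K (circ' e e' t) (circ' e e' t') =
      (volume K).toReal - 2 * (turnVol K e e' t' - turnVol K e e' t) := by
  have e1 : volSign K (circ' e e' t) (circ' e e' t') =
      ∫ x in K, (1 - 2 * ((turns t' (planeCoord e e' x) : ℝ) - turns t (planeCoord e e' x))) := by
    refine integral_congr_ae ?_
    filter_upwards [h.ae_rotIm_ne_zero K t, h.ae_rotIm_ne_zero K t'] with x hx hx'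
    rw [← sg_rotIm_mul h1 h2 hx hx', rotIm_planeCoord, rotIm_planeCoord]
  have hc : Integrable (fun _ : E3 => (1 : ℝ)) (volume.restrict K) :=
    integrableOn_const hK.volume_lt_top.ne
  have hd : Integrable (fun x => 2 * ((turns t' (planeCoord e e' x) : ℝ) -
      turns t (planeCoord e e' x))) (volume.restrict K) :=
    ((integrable_turns hK e e' t').sub (integrable_turns hK e e' t)).const_mul 2
  rw [e1, integral_sub hc hd,
    integral_const_mul, integral_sub (integrable_turns hK e e' t') (integrable_turns hK e e' t)]
  simp [Measure.real, turnVol]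

lemma volSign_lt {u v y : E3} (h1 : ⟪u, y⟫_ℝ * ⟪v, y⟫_ℝ < 0) :
    volSign K u v < (volume K).toReal := by
  have hm : Measurable fun x : E3 => sg (⟪u, x⟫_ℝ * ⟪v, x⟫_ℝ) := measurable_sg.comp (by fun_prop)
  have hi : Integrable (fun x : E3 => sg (⟪u, x⟫_ℝ * ⟪v, x⟫_ℝ)) (volume.restrict K) :=
    (integrableOn_const (C := (1 : ℝ)) hK.volume_lt_top.ne).mono' hm.aestronglyMeasurable
      (.of_forall fun _ => abs_sg_le _)
  have hc : Integrable (fun _ : E3 => (1 : ℝ)) (volume.restrict K) :=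
    integrableOn_const hK.volume_lt_top.ne
  have e1 : (volume K).toReal = ∫ x in K, (1 : ℝ) := by simp [Measure.real]
  rw [e1, ← sub_pos, volSign, ← integral_sub hc hi]
  refine (integral_pos_iff_support_of_nonneg (fun x => sub_nonneg.2 ?_) (hc.sub hi)).2 ?_
  · exact (abs_le.1 (abs_sg_le _)).2
  · set U : Set E3 := interior K ∩ {x | ⟪u, x⟫_ℝ * ⟪v, x⟫_ℝ < 0}
    have hUo : IsOpen U := isOpen_interior.inter (isOpen_lt (by fun_prop) (by fun_prop))
    have hUn : U.Nonempty := by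
      have h2 : Tendsto (fun t : ℝ => t • y) (𝓝[>] 0) (𝓝 0) := by
        have : Continuous fun t : ℝ => t • y := by fun_prop
        simpa using (this.tendsto 0).mono_left (nhdsWithin_le_nhds (s := Set.Ioi 0))
      obtain ⟨t, ht, ht0⟩ := ((h2.eventually (isOpen_interior.mem_nhds
        hK.zero_mem_interior)).and self_mem_nhdsWithin).exists
      replace ht0 : 0 < t := ht0
      refine ⟨_, ht, ?_⟩
      simp only [Set.mem_ofPred_eq, real_inner_smul_right]
      rw [mul_mul_mul_comm]
      exact mul_neg_of_pos_of_neg (mul_pos ht0 ht0) h1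
    have hle : U ⊆ Function.support fun x => 1 - sg (⟪u, x⟫_ℝ * ⟪v, x⟫_ℝ) := by
      intro x hx
      have : ⟪u, x⟫_ℝ * ⟪v, x⟫_ℝ < 0 := hx.2
      rw [Function.mem_support, sg_of_neg this]
      norm_num
    refine lt_of_lt_of_le ?_ (measure_mono hle)
    rw [Measure.restrict_apply hUo.measurableSet,
      Set.inter_eq_left.2 (Set.inter_subset_left.trans interior_subset)]
    exact hUo.measure_pos volume hUn

lemma turnVol_strictMono {e e' : E3} (h : Orth e e') : StrictMono (turnVol K e e') := by
  intro t t' htt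
  obtain ⟨r, hr⟩ : ∃ r, r = min t' (t + Real.pi / 2) := ⟨_, rfl⟩
  have hpi := Real.pi_pos
  have h1 : t < r := by rw [hr]; exact lt_min htt (by linarith)
  have h2 : r ≤ t + Real.pi / 2 := hr ▸ min_le_right _ _
  have h3 : r ≤ t' := hr ▸ min_le_left _ _
  refine lt_of_lt_of_le ?_ (turnVol_mono hK e e' h3)
  have h4 := volSign_circ' hK h h1.le (by linarith)
  have h5 := volSign_lt hK (u := circ' e e' t) (v := circ' e e' r) (y := circ e e' ((t + r) / 2)) (by
    rw [h.inner_circ'_circ, h.inner_circ'_circ]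
    refine mul_neg_of_pos_of_neg (Real.sin_pos_of_pos_of_lt_pi (by linarith) (by linarith))
      (Real.sin_neg_of_neg_of_neg_pi_lt (by linarith) (by linarith)))
  linarith

lemma turnVol_rotate {e e' : E3} (h : Orth e e') (φ t : ℝ) :
    turnVol K (circ e e' φ) (circ' e e' φ) t = turnVol K e e' (φ + t) - turnVol K e e' φ := by
  rw [turnVol, turnVol, turnVol,
    ← integral_sub (integrable_turns hK e e' (φ + t)) (integrable_turns hK e e' φ)]
  refine integral_congr_ae ?_
  filter_upwards [h.ae_rotIm_ne_zero K 0] with x h0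
  have hz : planeCoord e e' x ≠ 0 := fun h1 => h0 (by simp [h1, rotIm])
  rw [planeCoord_rotate, turns_rot hz]
  push_cast
  rfl

lemma continuousAt_turnVol {e e' : E3} (h : Orth e e') (t : ℝ) :
    ContinuousAt (fun w : E3 × E3 × ℝ => turnVol K w.1 w.2.1 w.2.2) (e, e', t) := by
  refine continuousAt_of_dominated (bound := fun _ => (|t| + 1) / Real.pi + 1) ?_ ?_ ?_ ?_
  · exact .of_forall fun w => (measurable_turns_planeCoord _ _ _).aestronglyMeasurable
  · have h1 : Continuous fun w : E3 × E3 × ℝ => |w.2.2| := by fun_prop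
    filter_upwards [(h1.tendsto (e, e', t)).eventually_lt_const (lt_add_one |t|)] with w hw
    refine .of_forall fun x => (abs_turns_le _ _).trans ?_
    gcongr
  · exact integrableOn_const hK.volume_lt_top.ne
  · filter_upwards [h.ae_rotIm_ne_zero K 0, h.ae_rotIm_ne_zero K t] with x h0 ht
    have h1 : Continuous fun w : E3 × E3 × ℝ => (w.2.2, planeCoord w.1 w.2.1 x) :=
      Continuous.prodMk (by fun_prop)
        (continuous_planeCoord.comp (f := fun w : E3 × E3 × ℝ => (w.1, w.2.1, x)) (by fun_prop))
    exact ContinuousAt.comp (f := fun w : E3 × E3 × ℝ => (w.2.2, planeCoord w.1 w.2.1 x))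
      (x := (e, e', t)) (continuousAt_turns h0 ht) h1.continuousAt

lemma exists_turnVol_eq {e e' : E3} (h : Orth e e') (y : ℝ) : ∃ t, turnVol K e e' t = y := by
  have hcont : Continuous (turnVol K e e') := by
    refine continuous_iff_continuousAt.2 fun t => ?_
    exact ContinuousAt.comp (f := fun t : ℝ => (e, e', t)) (x := t) (continuousAt_turnVol hK h t)
      (by fun_prop)
  have hv := hK.volume_pos
  have h1 : ∀ n : ℕ, turnVol K e e' (n * Real.pi) = n * (volume K).toReal := by
    intro n
    induction n with
    | zero => simp [turnVol_zero]
    | succ n ih =>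
      push_cast
      rw [add_mul, one_mul, turnVol_add_pi hK, ih]
      ring
  have h2 : ∀ n : ℕ, turnVol K e e' (-n * Real.pi) = -n * (volume K).toReal := by
    intro n
    induction n with
    | zero => simp [turnVol_zero]
    | succ n ih =>
      have h3 := turnVol_add_pi hK e e' (-((n + 1 : ℕ) : ℝ) * Real.pi)
      have h4 : -((n + 1 : ℕ) : ℝ) * Real.pi + Real.pi = -n * Real.pi := by push_cast; ring
      rw [h4, ih] at h3
      push_cast at h3 ⊢
      linarith
  obtain ⟨n, hn⟩ := exists_nat_ge (|y| / (volume K).toReal)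
  rw [div_le_iff₀ hv] at hn
  refine mem_range_of_exists_le_of_exists_ge hcont ⟨_, (h2 n).le.trans ?_⟩ ⟨_, le_trans ?_ (h1 n).ge⟩
  · linarith [neg_abs_le y]
  · linarith [le_abs_self y]

end

/-- The angle at which the rotating half-plane of `turnVol` has swept `s / 2` of the volume. -/
def turnAngle (K : Set E3) (e e' : E3) (s : ℝ) : ℝ :=
  open Classical in
    if h : ∃ t, turnVol K e e' t = s * (volume K).toReal / 2 then h.choose else 0

section

variable {K : Set E3} (hK : SymBody K)

include hK

lemma turnVol_turnAngle {e e' : E3} (h : Orth e e') (s : ℝ) :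
    turnVol K e e' (turnAngle K e e' s) = s * (volume K).toReal / 2 := by
  have h1 := exists_turnVol_eq hK h (s * (volume K).toReal / 2)
  rw [turnAngle, dif_pos h1]
  exact h1.choose_spec

lemma turnAngle_eq {e e' : E3} (h : Orth e e') {s t : ℝ}
    (ht : turnVol K e e' t = s * (volume K).toReal / 2) : turnAngle K e e' s = t :=
  (turnVol_strictMono hK h).injective ((turnVol_turnAngle hK h s).trans ht.symm)

lemma turnAngle_add_two {e e' : E3} (h : Orth e e') (s : ℝ) :
    turnAngle K e e' (s + 2) = turnAngle K e e' s + Real.pi := by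
  refine turnAngle_eq hK h ?_
  rw [turnVol_add_pi hK, turnVol_turnAngle hK h]
  ring

lemma turnAngle_strictMono {e e' : E3} (h : Orth e e') : StrictMono (turnAngle K e e') := by
  intro s s' hs
  rw [← (turnVol_strictMono hK h).lt_iff_lt, turnVol_turnAngle hK h, turnVol_turnAngle hK h]
  have := mul_lt_mul_of_pos_right hs hK.volume_pos
  linarith

lemma turnAngle_neg {e e' : E3} (h : Orth e e') (s : ℝ) :
    turnAngle K e (-e') (-s) = -turnAngle K e e' s := by
  refine turnAngle_eq hK h.neg_right ?_
  rw [turnVol_neg K h, turnVol_turnAngle hK h]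
  ring

lemma turnAngle_rotate {e e' : E3} (h : Orth e e') (s₀ s : ℝ) :
    turnAngle K (circ e e' (turnAngle K e e' s₀)) (circ' e e' (turnAngle K e e' s₀)) s =
      turnAngle K e e' (s₀ + s) - turnAngle K e e' s₀ := by
  refine turnAngle_eq hK (h.rotate _) ?_
  rw [turnVol_rotate hK h, add_sub_cancel, turnVol_turnAngle hK h, turnVol_turnAngle hK h]
  ring

lemma volSign_turnAngle {e e' : E3} (h : Orth e e') (s : ℝ) :
    volSign K (circ' e e' (turnAngle K e e' s)) (circ' e e' (turnAngle K e e' (s + 1))) = 0 := by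
  have hm := (turnAngle_strictMono hK h).monotone
  rw [volSign_circ' hK h (hm (by linarith)), turnVol_turnAngle hK h, turnVol_turnAngle hK h]
  · ring
  · rw [← turnAngle_add_two hK h]
    exact hm (by linarith)

lemma continuous_turnAngle {X : Type*} [TopologicalSpace X] {e e' : X → E3} {s : X → ℝ}
    (h : ∀ x, Orth (e x) (e' x)) (he : Continuous e) (he' : Continuous e') (hs : Continuous s) :
    Continuous fun x => turnAngle K (e x) (e' x) (s x) := by
  refine continuous_iff_continuousAt.2 fun x₀ => ?_
  refine continuousAt_root
    (G := fun x t => turnVol K (e x) (e' x) t - s x * (volume K).toReal / 2) ?_ ?_ ?_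
  · intro t
    have h1 : Continuous fun x => (e x, e' x, t) := by fun_prop
    have h2 := ContinuousAt.comp (f := fun x => (e x, e' x, t)) (x := x₀)
      (continuousAt_turnVol hK (h x₀) t) h1.continuousAt
    have h3 : Continuous fun x => s x * (volume K).toReal / 2 := by fun_prop
    exact h2.sub h3.continuousAt
  · refine .of_forall fun x t t' htt => ?_
    have := turnVol_strictMono hK (h x) htt
    dsimp only
    linarith
  · refine .of_forall fun x => ?_
    rw [turnVol_turnAngle hK (h x), sub_self]

end

lemma inner_E3 (x y : E3) : ⟪x, y⟫_ℝ = x 0 * y 0 + x 1 * y 1 + x 2 * y 2 := by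
  simp only [PiLp.inner_apply, Fin.sum_univ_three, RCLike.inner_apply, conj_trivial]
  ring

/-- The cross product of two vectors in space. -/
def cross (a b : E3) : E3 :=
  !₂[a 1 * b 2 - a 2 * b 1, a 2 * b 0 - a 0 * b 2, a 0 * b 1 - a 1 * b 0]

lemma cross_zero (a b : E3) : cross a b 0 = a 1 * b 2 - a 2 * b 1 := rfl

lemma cross_one (a b : E3) : cross a b 1 = a 2 * b 0 - a 0 * b 2 := rfl

lemma cross_two (a b : E3) : cross a b 2 = a 0 * b 1 - a 1 * b 0 := rfl

lemma ext_E3 {x y : E3} (h0 : x 0 = y 0) (h1 : x 1 = y 1) (h2 : x 2 = y 2) : x = y := by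
  ext i
  fin_cases i
  exacts [h0, h1, h2]

lemma continuous_cross : Continuous fun v : E3 × E3 => cross v.1 v.2 := by
  unfold cross
  fun_prop

lemma cross_comm (a b : E3) : cross a b = -cross b a := by
  apply ext_E3 <;> simp only [cross_zero, cross_one, cross_two, PiLp.neg_apply] <;> ring

lemma cross_neg_left (a b : E3) : cross (-a) b = -cross a b := by
  apply ext_E3 <;> simp only [cross_zero, cross_one, cross_two, PiLp.neg_apply] <;> ring

lemma cross_neg_right (a b : E3) : cross a (-b) = -cross a b := by
  rw [cross_comm, cross_neg_left, ← cross_comm]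

lemma cross_shear (a b : E3) (c : ℝ) : cross a (c • a + b) = cross a b := by
  apply ext_E3 <;> simp only [cross_zero, cross_one, cross_two, PiLp.add_apply, PiLp.smul_apply,
    smul_eq_mul] <;> ring

lemma cross_smul_add_smul (a b b' : E3) (s t : ℝ) :
    cross a (s • b + t • b') = s • cross a b + t • cross a b' := by
  apply ext_E3 <;> simp only [cross_zero, cross_one, cross_two, PiLp.add_apply, PiLp.smul_apply,
    smul_eq_mul] <;> ring

lemma inner_cross_left (a b : E3) : ⟪cross a b, a⟫_ℝ = 0 := by
  simp only [inner_E3, cross_zero, cross_one, cross_two]; ring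

lemma inner_cross_right (a b : E3) : ⟪cross a b, b⟫_ℝ = 0 := by
  simp only [inner_E3, cross_zero, cross_one, cross_two]; ring

lemma inner_cross_cyclic (a b c : E3) : ⟪cross b c, a⟫_ℝ = ⟪cross a b, c⟫_ℝ := by
  simp only [inner_E3, cross_zero, cross_one, cross_two]; ring

lemma LI.of_inner_cross {a b c : E3} (h : ⟪cross a b, c⟫_ℝ ≠ 0) : LI a b := by
  rw [li_iff]
  intro s t hst
  have h1 : ⟪cross (s • a + t • b) b, c⟫_ℝ = s * ⟪cross a b, c⟫_ℝ := by
    simp only [inner_E3, cross_zero, cross_one, cross_two, PiLp.add_apply, PiLp.smul_apply,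
      smul_eq_mul]
    ring
  have h2 : ⟪cross a (s • a + t • b), c⟫_ℝ = t * ⟪cross a b, c⟫_ℝ := by
    simp only [inner_E3, cross_zero, cross_one, cross_two, PiLp.add_apply, PiLp.smul_apply,
      smul_eq_mul]
    ring
  have h3 : ∀ x : E3, cross 0 x = 0 := fun x => by
    apply ext_E3 <;> simp [cross_zero, cross_one, cross_two]
  have h4 : ∀ x : E3, cross x 0 = 0 := fun x => by
    apply ext_E3 <;> simp [cross_zero, cross_one, cross_two]
  rw [hst, h3, inner_zero_left, eq_comm] at h1
  rw [hst, h4, inner_zero_left, eq_comm] at h2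
  exact ⟨(mul_eq_zero.1 h1).resolve_right h, (mul_eq_zero.1 h2).resolve_right h⟩

/-- The vector `P` moved parallel to `n` so that together with `n` it spans lines which split the
plane section of `K` into quadrants of equal area. -/
def tilt (K : Set E3) (n P : E3) : E3 := secSlope K n P • n + P

/-- The signed area of the section of `K` by the plane of the tilts of `P` and `Q`. -/
def defectA (K : Set E3) (n P Q : E3) : ℝ := secSign K (tilt K n P) (tilt K n Q)

/-- The signed volumes for the plane of the tilts of `P` and `Q` together with the planes of `n`
and `P`, and of `n` and `Q`. -/
def defectB (K : Set E3) (n P Q : E3) : ℂ :=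
  ⟨volSign K (cross n P) (cross (tilt K n P) (tilt K n Q)),
    volSign K (cross n Q) (cross (tilt K n P) (tilt K n Q))⟩

lemma inner_cross_tilt (K : Set E3) (n P Q : E3) :
    ⟪cross (tilt K n P) (tilt K n Q), n⟫_ℝ = ⟪cross n P, Q⟫_ℝ := by
  simp only [tilt, inner_E3, cross_zero, cross_one, cross_two, PiLp.add_apply, PiLp.smul_apply,
    smul_eq_mul]
  ring

section

variable {K : Set E3} (hK : SymBody K)

include hK

lemma tilt_neg_right {n P : E3} (h : LI P n) : tilt K n (-P) = -tilt K n P := by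
  rw [tilt, tilt, secSlope_neg_right hK h]
  module

lemma tilt_neg_left {n P : E3} (h : LI P n) : tilt K (-n) P = tilt K n P := by
  rw [tilt, tilt, secSlope_neg_left hK h]
  module

lemma defectA_rotate {n P Q : E3} (hP : LI P n) :
    defectA K n Q (-P) = -defectA K n P Q := by
  rw [defectA, defectA, tilt_neg_right hK hP, secSign_neg_right hK, secSign_comm hK]

lemma defectB_rotate {n P Q : E3} (hP : LI P n) :
    defectB K n Q (-P) = -Complex.I * defectB K n P Q := by
  rw [defectB, defectB, tilt_neg_right hK hP, cross_neg_right, cross_neg_right, ← cross_comm,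
    volSign_neg_left]
  apply Complex.ext <;> simp

lemma defectA_reflect {n P Q : E3} (hP : LI P n) (hQ : LI Q n) :
    defectA K (-n) (-Q) (-P) = defectA K n P Q := by
  rw [defectA, defectA, tilt_neg_left hK hP.neg_left, tilt_neg_left hK hQ.neg_left,
    tilt_neg_right hK hP, tilt_neg_right hK hQ, secSign_neg_right hK, secSign_neg_left hK, neg_neg,
    secSign_comm hK]

lemma defectB_reflect {n P Q : E3} (hP : LI P n) (hQ : LI Q n) :
    defectB K (-n) (-Q) (-P) = -Complex.I * (starRingEnd ℂ) (defectB K n P Q) := by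
  rw [defectB, defectB, tilt_neg_left hK hP.neg_left, tilt_neg_left hK hQ.neg_left,
    tilt_neg_right hK hP, tilt_neg_right hK hQ]
  simp only [cross_neg_left, cross_neg_right, neg_neg]
  rw [cross_comm (tilt K n Q), volSign_neg_right, volSign_neg_right]
  apply Complex.ext <;> simp

variable {X : Type*} [TopologicalSpace X] {n P Q : X → E3}

lemma continuous_tilt (hn : Continuous n) (hP : Continuous P) (h : ∀ x, LI (P x) (n x)) :
    Continuous fun x => tilt K (n x) (P x) := by
  have h1 : Continuous fun x => secSlope K (n x) (P x) := by
    refine continuous_iff_continuousAt.2 fun x => ?_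
    have h2 : Continuous fun x => (n x, P x) := by fun_prop
    exact ContinuousAt.comp (f := fun x => (n x, P x)) (x := x)
      (continuousAt_secSlope hK (h x)) h2.continuousAt
  unfold tilt
  fun_prop

lemma continuous_defectA (hn : Continuous n) (hP : Continuous P) (hQ : Continuous Q)
    (h : ∀ x, ⟪cross (n x) (P x), Q x⟫_ℝ ≠ 0) :
    Continuous fun x => defectA K (n x) (P x) (Q x) := by
  have h1 := continuous_tilt hK hn hP fun x => (LI.of_inner_cross (h x)).symm
  have h2 := continuous_tilt hK hn hQ fun x => LI.of_inner_cross (c := P x) (by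
    rw [inner_cross_cyclic, inner_cross_cyclic]; exact h x)
  refine continuous_iff_continuousAt.2 fun x => ?_
  exact ContinuousAt.comp (f := fun x => (tilt K (n x) (P x), tilt K (n x) (Q x))) (x := x)
    (continuousAt_secSign hK (LI.of_inner_cross (by rw [inner_cross_tilt]; exact h x)))
    (h1.prodMk h2).continuousAt

lemma continuous_volSign {u v : X → E3} (hu : Continuous u) (hv : Continuous v)
    (hu0 : ∀ x, u x ≠ 0) (hv0 : ∀ x, v x ≠ 0) : Continuous fun x => volSign K (u x) (v x) :=
  continuous_iff_continuousAt.2 fun x => ContinuousAt.comp (f := fun x => (u x, v x)) (x := x)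
    (continuousAt_volSign hK (hu0 x) (hv0 x)) (hu.prodMk hv).continuousAt

lemma continuous_defectB (hn : Continuous n) (hP : Continuous P) (hQ : Continuous Q)
    (h : ∀ x, ⟪cross (n x) (P x), Q x⟫_ℝ ≠ 0) :
    Continuous fun x => defectB K (n x) (P x) (Q x) := by
  have h' : ∀ x, ⟪cross (Q x) (n x), P x⟫_ℝ ≠ 0 := fun x => by
    rw [inner_cross_cyclic, inner_cross_cyclic]; exact h x
  have h1 := continuous_tilt hK hn hP fun x => (LI.of_inner_cross (h x)).symm
  have h2 := continuous_tilt hK hn hQ fun x => LI.of_inner_cross (h' x)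
  have h3 := continuous_cross.comp (h1.prodMk h2)
  have h4 : ∀ x, cross (tilt K (n x) (P x)) (tilt K (n x) (Q x)) ≠ 0 := fun x h0 => by
    have := inner_cross_tilt K (n x) (P x) (Q x)
    rw [h0, inner_zero_left] at this
    exact h x this.symm
  have h5 : ∀ x, cross (n x) (P x) ≠ 0 := fun x h0 => h x (by rw [h0, inner_zero_left])
  have h6 : ∀ x, cross (n x) (Q x) ≠ 0 := fun x h0 => h' x (by
    rw [cross_comm, h0, neg_zero, inner_zero_left])
  have hre := continuous_volSign hK (continuous_cross.comp (hn.prodMk hP)) h3 h5 h4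
  have him := continuous_volSign hK (continuous_cross.comp (hn.prodMk hQ)) h3 h6 h4
  have e : (fun x => defectB K (n x) (P x) (Q x)) = fun x =>
      ((defectB K (n x) (P x) (Q x)).re : ℂ) + (defectB K (n x) (P x) (Q x)).im * Complex.I :=
    funext fun x => (Complex.re_add_im _).symm
  rw [e]
  exact (Complex.continuous_ofReal.comp hre).add
    ((Complex.continuous_ofReal.comp him).mul continuous_const)

end

/-- The radial vector of spherical coordinates. -/
def frameN (ρ φ : ℝ) : E3 := !₂[Real.sin ρ * Real.cos φ, Real.sin ρ * Real.sin φ, Real.cos ρ]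

/-- The polar tangent vector of spherical coordinates. -/
def frameE (ρ φ : ℝ) : E3 := !₂[Real.cos ρ * Real.cos φ, Real.cos ρ * Real.sin φ, -Real.sin ρ]

/-- The azimuthal tangent vector of spherical coordinates. -/
def frameF (φ : ℝ) : E3 := !₂[-Real.sin φ, Real.cos φ, 0]

lemma continuous_frameN {X : Type*} [TopologicalSpace X] {ρ φ : X → ℝ} (hρ : Continuous ρ)
    (hφ : Continuous φ) : Continuous fun x => frameN (ρ x) (φ x) := by
  unfold frameN
  fun_prop

lemma continuous_frameE : Continuous fun v : ℝ × ℝ => frameE v.1 v.2 := by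
  unfold frameE
  fun_prop

lemma continuous_frameF : Continuous frameF := by
  unfold frameF
  fun_prop

lemma orth_frame (ρ φ : ℝ) : Orth (frameE ρ φ) (frameF φ) where
  left := by
    simp only [inner_E3, frameE, Matrix.cons_val]
    linear_combination (Real.cos ρ) ^ 2 * Real.sin_sq_add_cos_sq φ + Real.sin_sq_add_cos_sq ρ
  right := by
    simp only [inner_E3, frameF, Matrix.cons_val]
    linear_combination Real.sin_sq_add_cos_sq φ
  mixed := by
    simp only [inner_E3, frameE, frameF, Matrix.cons_val]
    ring

lemma cross_frameN (ρ φ t : ℝ) :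
    cross (frameN ρ φ) (circ (frameE ρ φ) (frameF φ) t) = circ' (frameE ρ φ) (frameF φ) t := by
  have h1 := Real.sin_sq_add_cos_sq φ
  have h2 := Real.sin_sq_add_cos_sq ρ
  have hE : cross (frameN ρ φ) (frameE ρ φ) = frameF φ := by
    apply ext_E3 <;> simp only [cross_zero, cross_one, cross_two, frameN, frameE, frameF,
      PiLp.toLp_apply, Matrix.cons_val]
    · linear_combination (-Real.sin φ) * h2
    · linear_combination (Real.cos φ) * h2
    · ring
  have hF : cross (frameN ρ φ) (frameF φ) = -frameE ρ φ := by
    apply ext_E3 <;> simp only [cross_zero, cross_one, cross_two, frameN, frameE, frameF,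
      Matrix.cons_val, PiLp.neg_apply]
    · ring
    · ring
    · linear_combination (Real.sin ρ) * h1
  rw [circ, cross_smul_add_smul, hE, hF, circ']
  module

lemma frameN_add_pi (φ : ℝ) :
    frameN (Real.pi / 2) (φ + Real.pi) = -frameN (Real.pi / 2) φ := by
  apply ext_E3 <;> simp [frameN, Real.cos_add_pi, Real.sin_add_pi]

lemma frameE_add_pi (φ : ℝ) : frameE (Real.pi / 2) (φ + Real.pi) = frameE (Real.pi / 2) φ := by
  apply ext_E3 <;> simp [frameE]

lemma frameF_add_pi (φ : ℝ) : frameF (φ + Real.pi) = -frameF φ := by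
  apply ext_E3 <;> simp [frameF, Real.cos_add_pi, Real.sin_add_pi]

lemma frameN_zero (φ : ℝ) : frameN 0 φ = frameN 0 0 := by
  apply ext_E3 <;> simp [frameN]

lemma frameE_zero (φ : ℝ) : frameE 0 φ = circ (frameE 0 0) (frameF 0) φ := by
  apply ext_E3 <;> simp [frameE, frameF, circ]

lemma frameF_eq_circ' (φ : ℝ) : frameF φ = circ' (frameE 0 0) (frameF 0) φ := by
  apply ext_E3 <;> simp [circ', frameE, frameF]

/-- The azimuth, in terms of the volume swept around the north pole. -/
def azim (K : Set E3) (φ : ℝ) : ℝ := turnAngle K (frameE 0 0) (frameF 0) φ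

/-- The tangent direction at a point of the sphere at which the half-plane rotating around the
radial vector has swept `s / 2` of the volume of `K`. -/
def dir (K : Set E3) (ρ φ s : ℝ) : E3 :=
  circ (frameE ρ φ) (frameF φ) (turnAngle K (frameE ρ φ) (frameF φ) s)

lemma dir_add_two_pi (K : Set E3) (ρ φ s : ℝ) : dir K ρ (φ + Real.pi + Real.pi) s = dir K ρ φ s := by
  have h : frameE ρ (φ + Real.pi + Real.pi) = frameE ρ φ := by
    apply ext_E3 <;> simp [frameE, Real.cos_add_pi, Real.sin_add_pi]
  rw [dir, dir, h, frameF_add_pi, frameF_add_pi, neg_neg]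

section

variable {K : Set E3} (hK : SymBody K)

include hK

lemma azim_add_two (φ : ℝ) : azim K (φ + 2) = azim K φ + Real.pi :=
  turnAngle_add_two hK (orth_frame 0 0) φ

lemma continuous_azim : Continuous (azim K) :=
  continuous_turnAngle hK (fun _ => orth_frame 0 0) continuous_const continuous_const continuous_id

lemma dir_add_two (ρ φ s : ℝ) : dir K ρ φ (s + 2) = -dir K ρ φ s := by
  rw [dir, turnAngle_add_two hK (orth_frame ρ φ), circ_add_pi, dir]

lemma dir_add_pi (φ s : ℝ) :
    dir K (Real.pi / 2) (φ + Real.pi) s = dir K (Real.pi / 2) φ (-s) := by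
  have h := turnAngle_neg hK (orth_frame (Real.pi / 2) φ) (-s)
  rw [neg_neg] at h
  rw [dir, frameE_add_pi, frameF_add_pi, h, circ_neg_right, dir]

lemma dir_zero (φ s : ℝ) :
    dir K 0 (azim K φ) s = circ (frameE 0 0) (frameF 0) (azim K (φ + s)) := by
  rw [dir, frameE_zero, frameF_eq_circ' (azim K φ), azim, turnAngle_rotate hK (orth_frame 0 0), circ_rotate,
    add_sub_cancel, azim]

lemma inner_cross_dir (ρ φ s : ℝ) :
    ⟪cross (frameN ρ φ) (dir K ρ φ s), dir K ρ φ (s + 1)⟫_ℝ ≠ 0 := by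
  rw [dir, dir, cross_frameN, (orth_frame ρ φ).inner_circ'_circ]
  have hm := turnAngle_strictMono hK (orth_frame ρ φ)
  have h1 := hm (show s < s + 1 by linarith)
  have h2 := hm (show s + 1 < s + 2 by linarith)
  rw [turnAngle_add_two hK (orth_frame ρ φ)] at h2
  exact (Real.sin_pos_of_pos_of_lt_pi (by linarith) (by linarith)).ne'

lemma volSign_cross_dir (ρ φ s : ℝ) :
    volSign K (cross (frameN ρ φ) (dir K ρ φ s)) (cross (frameN ρ φ) (dir K ρ φ (s + 1))) = 0 := by
  rw [dir, dir, cross_frameN, cross_frameN, volSign_turnAngle hK (orth_frame ρ φ)]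

lemma continuous_dir {X : Type*} [TopologicalSpace X] {ρ φ s : X → ℝ} (hρ : Continuous ρ)
    (hφ : Continuous φ) (hs : Continuous s) : Continuous fun x => dir K (ρ x) (φ x) (s x) := by
  have hE := continuous_frameE.comp (hρ.prodMk hφ)
  have hF := continuous_frameF.comp hφ
  have hT := continuous_turnAngle hK (fun x => orth_frame (ρ x) (φ x)) hE hF hs
  exact ((Real.continuous_cos.comp hT).smul hE).add ((Real.continuous_sin.comp hT).smul hF)

/-- There are a vector `n` and two vectors `P`, `Q` orthogonal to it for which all equipartition
defects vanish. -/
theorem exists_defect_eq_zero : ∃ n P Q : E3, ⟪cross n P, Q⟫_ℝ ≠ 0 ∧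
    volSign K (cross n P) (cross n Q) = 0 ∧ defectA K n P Q = 0 ∧ defectB K n P Q = 0 := by
  have hli : ∀ ρ φ s, LI (dir K ρ φ s) (frameN ρ φ) := fun ρ φ s =>
    (LI.of_inner_cross (inner_cross_dir hK ρ φ s)).symm
  have hcn : Continuous fun p : ℝ × ℝ × ℝ => frameN (p.1 * (Real.pi / 2)) (azim K p.2.1) :=
    continuous_frameN (continuous_fst.mul continuous_const)
      ((continuous_azim hK).comp (continuous_fst.comp continuous_snd))
  have hcd : ∀ c : ℝ, Continuous fun p : ℝ × ℝ × ℝ =>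
      dir K (p.1 * (Real.pi / 2)) (azim K p.2.1) (p.2.2 + c) := fun c =>
    continuous_dir hK (continuous_fst.mul continuous_const)
      ((continuous_azim hK).comp (continuous_fst.comp continuous_snd))
      ((continuous_snd.comp continuous_snd).add continuous_const)
  have hcd0 : Continuous fun p : ℝ × ℝ × ℝ =>
      dir K (p.1 * (Real.pi / 2)) (azim K p.2.1) p.2.2 := by simpa using hcd 0
  have hshift : ∀ ρ φ s, dir K ρ φ (s + 1 + 1) = -dir K ρ φ s := fun ρ φ s => by
    rw [add_assoc, one_add_one_eq_two, dir_add_two hK]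
  have hn4 : ∀ ρ φ, frameN ρ (azim K (φ + 4)) = frameN ρ (azim K φ) := fun ρ φ => by
    rw [show φ + 4 = φ + 2 + 2 by ring, azim_add_two hK, azim_add_two hK]
    apply ext_E3 <;> simp [frameN, Real.cos_add_pi, Real.sin_add_pi]
  have hd4 : ∀ ρ φ s, dir K ρ (azim K (φ + 4)) s = dir K ρ (azim K φ) s := fun ρ φ s => by
    rw [show φ + 4 = φ + 2 + 2 by ring, azim_add_two hK, azim_add_two hK, dir_add_two_pi]
  have href : ∀ φ s, dir K (Real.pi / 2) (azim K (φ + 2)) (1 - s) =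
      -dir K (Real.pi / 2) (azim K φ) (s + 1) := fun φ s => by
    rw [azim_add_two hK, dir_add_pi hK, show s + 1 = -(1 - s) + 2 by ring, dir_add_two hK, neg_neg]
  have href' : ∀ φ s, dir K (Real.pi / 2) (azim K (φ + 2)) (1 - s + 1) =
      -dir K (Real.pi / 2) (azim K φ) s := fun φ s => by
    rw [azim_add_two hK, dir_add_pi hK]
    nth_rw 2 [show s = -(1 - s + 1) + 2 by ring]
    rw [dir_add_two hK, neg_neg]
  have hzero : ∀ φ s, dir K 0 (azim K φ) s = dir K 0 (azim K (φ + s)) 0 := fun φ s => by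
    rw [dir_zero hK, dir_zero hK, add_zero]
  have hzero' : ∀ φ s, dir K 0 (azim K φ) (s + 1) = dir K 0 (azim K (φ + s)) (0 + 1) :=
    fun φ s => by rw [dir_zero hK, dir_zero hK, zero_add, add_assoc]
  have hcA : Continuous fun p : ℝ × ℝ × ℝ =>
      defectA K (frameN (p.1 * (Real.pi / 2)) (azim K p.2.1))
        (dir K (p.1 * (Real.pi / 2)) (azim K p.2.1) p.2.2)
        (dir K (p.1 * (Real.pi / 2)) (azim K p.2.1) (p.2.2 + 1)) :=
    continuous_defectA hK hcn hcd0 (hcd 1) fun p => inner_cross_dir hK _ _ _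
  have hcB : Continuous fun p : ℝ × ℝ × ℝ =>
      defectB K (frameN (p.1 * (Real.pi / 2)) (azim K p.2.1))
        (dir K (p.1 * (Real.pi / 2)) (azim K p.2.1) p.2.2)
        (dir K (p.1 * (Real.pi / 2)) (azim K p.2.1) (p.2.2 + 1)) :=
    continuous_defectB hK hcn hcd0 (hcd 1) fun p => inner_cross_dir hK _ _ _
  obtain ⟨r, φ, s, hA, hB⟩ := exists_common_zero
    (A := fun r φ s => defectA K (frameN (r * (Real.pi / 2)) (azim K φ))
      (dir K (r * (Real.pi / 2)) (azim K φ) s) (dir K (r * (Real.pi / 2)) (azim K φ) (s + 1)))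
    (B := fun r φ s => defectB K (frameN (r * (Real.pi / 2)) (azim K φ))
      (dir K (r * (Real.pi / 2)) (azim K φ) s) (dir K (r * (Real.pi / 2)) (azim K φ) (s + 1)))
    hcA hcB
    (fun r φ s => by simp only [hn4, hd4])
    (fun r φ s => by simp only [hn4, hd4])
    (fun r φ s => by rw [hshift]; exact defectA_rotate hK (hli _ _ _))
    (fun r φ s => by rw [hshift]; exact defectB_rotate hK (hli _ _ _))
    (fun φ s => by
      simp only [one_mul, href, href']
      rw [azim_add_two hK, frameN_add_pi]
      exact defectA_reflect hK (hli _ _ _) (hli _ _ _))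
    (fun φ s => by
      simp only [one_mul, href, href']
      rw [azim_add_two hK, frameN_add_pi]
      exact defectB_reflect hK (hli _ _ _) (hli _ _ _))
    (fun φ s => by
      simp only [zero_mul]
      rw [hzero φ s, hzero' φ s, frameN_zero, frameN_zero (azim K (φ + s))])
    (fun φ s => by
      simp only [zero_mul]
      rw [hzero φ s, hzero' φ s, frameN_zero, frameN_zero (azim K (φ + s))])
  exact ⟨_, _, _, inner_cross_dir hK _ _ _, volSign_cross_dir hK _ _ _, hA, hB⟩

end

/-- The sign attached to a label. -/
def boolSign (δ : Bool) : ℝ := if δ then 1 else -1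

open Classical in
lemma indicator_half (δ : Bool) {y : ℝ} (hy : y ≠ 0) :
    (if (if δ then 0 ≤ y else y ≤ 0) then (1 : ℝ) else 0) = (1 + boolSign δ * sg y) / 2 := by
  rcases hy.lt_or_gt with h | h <;> cases δ <;>
    simp [boolSign, sg_of_neg, sg_of_pos, h, h.le, h.not_ge]

lemma measurableSet_half (δ : Bool) : MeasurableSet {y : ℝ | if δ then 0 ≤ y else y ≤ 0} := by
  cases δ
  · exact measurableSet_Iic (a := (0 : ℝ))
  · exact measurableSet_Ici (a := (0 : ℝ))

lemma integral_odd {Ω : Type*} [MeasurableSpace Ω] {μ : Measure Ω} {N : Ω → Ω}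
    (hN : MeasurePreserving N μ μ) {F : Ω → ℝ} (hF : Measurable F) (hFN : ∀ x, F (N x) = -F x) :
    ∫ x, F x ∂μ = 0 := by
  have h1 : ∫ x, F x ∂μ = ∫ x, F (N x) ∂μ := by
    conv_lhs => rw [← hN.map_eq]
    exact integral_map hN.measurable.aemeasurable hF.aestronglyMeasurable
  simp only [hFN, integral_neg] at h1
  linarith

lemma integral_add_mul {Ω : Type*} [MeasurableSpace Ω] {μ : Measure Ω} {F G : Ω → ℝ}
    (hF : Integrable F μ) (hG : Integrable G μ) (hG0 : ∫ x, G x ∂μ = 0) (c : ℝ) :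
    Integrable (fun x => F x + c * G x) μ ∧ ∫ x, (F x + c * G x) ∂μ = ∫ x, F x ∂μ := by
  refine ⟨hF.add (hG.const_mul c), ?_⟩
  rw [integral_add hF (hG.const_mul c), integral_const_mul, hG0, mul_zero, add_zero]

section

variable {Ω : Type*} [MeasurableSpace Ω] {μ : Measure Ω} [IsFiniteMeasure μ] {N : Ω → Ω}
  (hN : MeasurePreserving N μ μ) {f g h : Ω → ℝ} (hf : Measurable f) (hg : Measurable g)
  (hh : Measurable h) (hfN : ∀ x, f (N x) = -f x) (hgN : ∀ x, g (N x) = -g x)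
  (hhN : ∀ x, h (N x) = -h x)

include hN hf hg hfN hgN

/-- Two odd functions with uncorrelated signs split a symmetric measure into quarters. -/
lemma measure_quadrant (hf0 : ∀ᵐ x ∂μ, f x ≠ 0) (hg0 : ∀ᵐ x ∂μ, g x ≠ 0)
    (hfg : ∫ x, sg (f x * g x) ∂μ = 0) (δ δ' : Bool) :
    μ {x | (if δ then 0 ≤ f x else f x ≤ 0) ∧ (if δ' then 0 ≤ g x else g x ≤ 0)} =
      μ Set.univ / 4 := by
  classical
  set S := {x | (if δ then 0 ≤ f x else f x ≤ 0) ∧ (if δ' then 0 ≤ g x else g x ≤ 0)}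
  have hS : MeasurableSet S := (hf (measurableSet_half δ)).inter (hg (measurableSet_half δ'))
  have hsf : Measurable fun x => sg (f x) := measurable_sg.comp hf
  have hsg : Measurable fun x => sg (g x) := measurable_sg.comp hg
  have hbd : ∀ {F : Ω → ℝ}, Measurable F → Integrable (fun x => sg (F x)) μ := fun hF =>
    (integrable_const (1 : ℝ)).mono' (measurable_sg.comp hF).aestronglyMeasurable
      (.of_forall fun _ => abs_sg_le _)
  have h1 : μ.real S = ∫ x, (1 / 4 + 1 * (boolSign δ / 4 * sg (f x) + boolSign δ' / 4 * sg (g x)) +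
      boolSign δ * boolSign δ' / 4 * sg (f x * g x)) ∂μ := by
    rw [← integral_indicator_one hS]
    refine integral_congr_ae ?_
    filter_upwards [hf0, hg0] with x hx hx'
    have e1 := indicator_half δ hx
    have e2 := indicator_half δ' hx'
    have e3 : S.indicator 1 x = (if (if δ then 0 ≤ f x else f x ≤ 0) then (1 : ℝ) else 0) *
        (if (if δ' then 0 ≤ g x else g x ≤ 0) then (1 : ℝ) else 0) := by
      by_cases c1 : (if δ then 0 ≤ f x else f x ≤ 0) <;>
        by_cases c2 : (if δ' then 0 ≤ g x else g x ≤ 0) <;> simp [S, Set.indicator, c1, c2]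
    rw [e3, e1, e2, sg_mul]
    ring
  have hodd := integral_odd hN (F := fun x => boolSign δ / 4 * sg (f x) + boolSign δ' / 4 * sg (g x))
    (by fun_prop) fun x => by rw [hfN, hgN, sg_neg, sg_neg]; ring
  have hio : Integrable (fun x => boolSign δ / 4 * sg (f x) + boolSign δ' / 4 * sg (g x)) μ :=
    ((hbd hf).const_mul _).add ((hbd hg).const_mul _)
  have hifg : Integrable (fun x => sg (f x * g x)) μ := hbd (hf.mul hg)
  obtain ⟨i1, e1⟩ := integral_add_mul (integrable_const (1 / 4 : ℝ)) hio hodd 1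
  rw [(integral_add_mul i1 hifg hfg _).2, e1, integral_const] at h1
  rw [← ENNReal.toReal_eq_toReal_iff' (measure_ne_top _ _)
    (ENNReal.div_ne_top (measure_ne_top _ _) (by norm_num))]
  rw [ENNReal.toReal_div]
  simp only [smul_eq_mul, Measure.real] at h1
  rw [h1]
  simp
  ring

include hh hhN

/-- Three odd functions with uncorrelated signs split a symmetric measure into eighths. -/
lemma measure_octant (hf0 : ∀ᵐ x ∂μ, f x ≠ 0) (hg0 : ∀ᵐ x ∂μ, g x ≠ 0) (hh0 : ∀ᵐ x ∂μ, h x ≠ 0)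
    (hfg : ∫ x, sg (f x * g x) ∂μ = 0) (hfh : ∫ x, sg (f x * h x) ∂μ = 0)
    (hgh : ∫ x, sg (g x * h x) ∂μ = 0) (δ δ' δ'' : Bool) :
    μ {x | ((if δ then 0 ≤ f x else f x ≤ 0) ∧ (if δ' then 0 ≤ g x else g x ≤ 0)) ∧
      (if δ'' then 0 ≤ h x else h x ≤ 0)} = μ Set.univ / 8 := by
  classical
  set S := {x | ((if δ then 0 ≤ f x else f x ≤ 0) ∧ (if δ' then 0 ≤ g x else g x ≤ 0)) ∧
      (if δ'' then 0 ≤ h x else h x ≤ 0)}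
  have hS : MeasurableSet S := ((hf (measurableSet_half δ)).inter (hg (measurableSet_half δ'))).inter
    (hh (measurableSet_half δ''))
  have hsf : Measurable fun x => sg (f x) := measurable_sg.comp hf
  have hsg : Measurable fun x => sg (g x) := measurable_sg.comp hg
  have hsh : Measurable fun x => sg (h x) := measurable_sg.comp hh
  have hsfgh : Measurable fun x => sg (f x * g x * h x) := measurable_sg.comp ((hf.mul hg).mul hh)
  have hbd : ∀ {F : Ω → ℝ}, Measurable F → Integrable (fun x => sg (F x)) μ := fun hF =>
    (integrable_const (1 : ℝ)).mono' (measurable_sg.comp hF).aestronglyMeasurable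
      (.of_forall fun _ => abs_sg_le _)
  set o : Ω → ℝ := fun x => boolSign δ / 8 * sg (f x) + boolSign δ' / 8 * sg (g x) +
    boolSign δ'' / 8 * sg (h x) + boolSign δ * boolSign δ' * boolSign δ'' / 8 * sg (f x * g x * h x)
    with ho
  have h1 : μ.real S = ∫ x, (1 / 8 + 1 * o x + boolSign δ * boolSign δ' / 8 * sg (f x * g x) +
      boolSign δ * boolSign δ'' / 8 * sg (f x * h x) +
      boolSign δ' * boolSign δ'' / 8 * sg (g x * h x)) ∂μ := by
    rw [← integral_indicator_one hS]
    refine integral_congr_ae ?_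
    filter_upwards [hf0, hg0, hh0] with x hx hx' hx''
    have e1 := indicator_half δ hx
    have e2 := indicator_half δ' hx'
    have e3 := indicator_half δ'' hx''
    have e4 : S.indicator 1 x = (if (if δ then 0 ≤ f x else f x ≤ 0) then (1 : ℝ) else 0) *
        (if (if δ' then 0 ≤ g x else g x ≤ 0) then (1 : ℝ) else 0) *
        (if (if δ'' then 0 ≤ h x else h x ≤ 0) then (1 : ℝ) else 0) := by
      by_cases c1 : (if δ then 0 ≤ f x else f x ≤ 0) <;>
        by_cases c2 : (if δ' then 0 ≤ g x else g x ≤ 0) <;>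
          by_cases c3 : (if δ'' then 0 ≤ h x else h x ≤ 0) <;> simp [S, Set.indicator, c1, c2, c3]
    rw [e4, e1, e2, e3, ho]
    simp only [sg_mul]
    ring
  have hodd := integral_odd hN (F := o) (by fun_prop) fun x => by
    simp only [ho, hfN, hgN, hhN, sg_neg, sg_mul]; ring
  have hio : Integrable o μ :=
    ((((hbd hf).const_mul _).add ((hbd hg).const_mul _)).add ((hbd hh).const_mul _)).add
      ((hbd ((hf.mul hg).mul hh)).const_mul _)
  have hifg : Integrable (fun x => sg (f x * g x)) μ := hbd (hf.mul hg)
  have hifh : Integrable (fun x => sg (f x * h x)) μ := hbd (hf.mul hh)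
  have high : Integrable (fun x => sg (g x * h x)) μ := hbd (hg.mul hh)
  obtain ⟨i1, e1⟩ := integral_add_mul (integrable_const (1 / 8 : ℝ)) hio hodd 1
  obtain ⟨i2, e2⟩ := integral_add_mul i1 hifg hfg (boolSign δ * boolSign δ' / 8)
  obtain ⟨i3, e3⟩ := integral_add_mul i2 hifh hfh (boolSign δ * boolSign δ'' / 8)
  rw [(integral_add_mul i3 high hgh _).2, e3, e2, e1, integral_const] at h1
  rw [← ENNReal.toReal_eq_toReal_iff' (measure_ne_top _ _)
    (ENNReal.div_ne_top (measure_ne_top _ _) (by norm_num))]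
  rw [ENNReal.toReal_div]
  simp only [smul_eq_mul, Measure.real] at h1
  rw [h1]
  simp
  ring

end

/-- The linear parametrization of the plane spanned by two vectors. -/
def planeLin (a b : E3) : ℝ × ℝ →ₗ[ℝ] E3 where
  toFun := planeMap a b
  map_add' q q' := by simp only [planeMap, Prod.fst_add, Prod.snd_add]; module
  map_smul' c q := by
    simp only [planeMap, Prod.smul_fst, Prod.smul_snd, smul_eq_mul, RingHom.id_apply]; module

lemma LI.planeMap_embedding {a b : E3} (h : LI a b) : MeasurableEmbedding (planeMap a b) := by
  refine (LinearMap.isClosedEmbedding_of_injective (f := planeLin a b) ?_).measurableEmbedding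
  refine LinearMap.ker_eq_bot'.2 fun q hq => ?_
  have := li_iff.1 h q.1 q.2 hq
  exact Prod.ext this.1 this.2

/-- In a linear parametrization, the Hausdorff measure of a plane is a multiple of the area. -/
lemma LI.exists_hausdorffMeasure_image {a b : E3} (h : LI a b) : ∃ c : ℝ≥0∞, ∀ S : Set (ℝ × ℝ),
    μH[(2 : ℝ)] (planeMap a b '' S) = c * volume S := by
  set ν : Measure (ℝ × ℝ) := (μH[(2 : ℝ)] : Measure E3).comap (planeMap a b) with hν
  have hap : ∀ S, ν S = μH[(2 : ℝ)] (planeMap a b '' S) := h.planeMap_embedding.comap_apply _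
  have hinv : ν.IsAddLeftInvariant := by
    refine ⟨fun v => ?_⟩
    ext S hS
    rw [Measure.map_apply (measurable_const_add v) hS, hap, hap]
    have e : planeMap a b '' S = (fun x => planeMap a b v + x) ''
        (planeMap a b '' ((fun q => v + q) ⁻¹' S)) := by
      rw [← Set.image_comp]
      have e1 : (fun x => planeMap a b v + x) ∘ planeMap a b = planeMap a b ∘ fun q => v + q :=
        funext fun q => ((planeLin a b).map_add v q).symm
      rw [e1, Set.image_comp, Set.image_preimage_eq _ (add_left_surjective v)]
    rw [e, (isometry_add_left _).hausdorffMeasure_image (.inl (by norm_num))]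
  have hfin : IsFiniteMeasureOnCompacts ν := by
    refine ⟨fun S hS => ?_⟩
    obtain ⟨C, hC⟩ : ∃ C, LipschitzWith C (planeMap a b) :=
      ⟨_, (LinearMap.toContinuousLinearMap (planeLin a b)).lipschitz⟩
    rw [hap]
    refine (hC.hausdorffMeasure_image_le (by norm_num) S).trans_lt ?_
    rw [hausdorffMeasure_prod_real]
    exact ENNReal.mul_lt_top (by simp) hS.measure_lt_top
  refine ⟨ν.addHaarScalarFactor volume, fun S => ?_⟩
  rw [← hap]
  exact congrArg (fun m : Measure (ℝ × ℝ) => m S) (Measure.isAddLeftInvariant_eq_smul ν volume)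

section

variable {K : Set E3} (hK : SymBody K)

include hK

lemma measurePreserving_neg_body :
    MeasurePreserving (fun x : E3 => -x) (volume.restrict K) (volume.restrict K) := by
  have h := (Measure.measurePreserving_neg (volume : Measure E3)).restrict_preimage hK.measurableSet
  have e : Neg.neg ⁻¹' K = K :=
    Set.ext fun x => ⟨fun hx => neg_neg x ▸ hK.neg_mem _ hx, fun hx => hK.neg_mem x hx⟩
  rwa [e] at h

lemma measurePreserving_neg_planeSec (a b : E3) :
    MeasurePreserving (fun q : ℝ × ℝ => -q) (volume.restrict (planeSec K a b))
      (volume.restrict (planeSec K a b)) := by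
  have h := (Measure.measurePreserving_neg (volume : Measure (ℝ × ℝ))).restrict_preimage
    (isClosed_planeSec hK a b).measurableSet
  have hn : ∀ q, q ∈ planeSec K a b → -q ∈ planeSec K a b := fun q hq => by
    have h1 : planeMap a b (-q) = -planeMap a b q := (planeLin a b).map_neg q
    exact (congrArg (· ∈ K) h1).mpr (hK.neg_mem _ hq)
  have e : Neg.neg ⁻¹' planeSec K a b = planeSec K a b :=
    Set.ext fun q => ⟨fun hq => neg_neg q ▸ hn _ hq, fun hq => hn q hq⟩
  rwa [e] at h

lemma hausdorffMeasure_section {a b c : E3} (hD : ⟪cross a b, c⟫_ℝ ≠ 0) (hs : secSign K b c = 0)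
    (δ δ' : Bool) :
    μH[(2 : ℝ)] (K ∩ {x | ⟪cross b c, x⟫_ℝ = 0} ∩
        {x | (if δ then 0 ≤ ⟪cross c a, x⟫_ℝ else ⟪cross c a, x⟫_ℝ ≤ 0) ∧
          (if δ' then 0 ≤ ⟪cross a b, x⟫_ℝ else ⟪cross a b, x⟫_ℝ ≤ 0)}) =
      μH[(2 : ℝ)] (K ∩ {x | ⟪cross b c, x⟫_ℝ = 0}) / 4 := by
  set D := ⟪cross a b, c⟫_ℝ with hDdef
  have hca : ∀ q, ⟪cross c a, planeMap b c q⟫_ℝ = D * q.1 := fun q => by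
    rw [hDdef, ← inner_cross_cyclic a b c, ← inner_cross_cyclic b c a, planeMap, inner_add_right,
      real_inner_smul_right, real_inner_smul_right, inner_cross_left]
    ring
  have hab : ∀ q, ⟪cross a b, planeMap b c q⟫_ℝ = D * q.2 := fun q => by
    rw [planeMap, inner_add_right, real_inner_smul_right, real_inner_smul_right,
      inner_cross_right]
    ring
  have hbc : ∀ q, ⟪cross b c, planeMap b c q⟫_ℝ = 0 := fun q => by
    rw [planeMap, inner_add_right, real_inner_smul_right, real_inner_smul_right,
      inner_cross_right, inner_cross_left]
    ring
  have hli : LI b c := LI.of_inner_cross (c := a) (by rwa [inner_cross_cyclic])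
  have himg : K ∩ {x | ⟪cross b c, x⟫_ℝ = 0} = planeMap b c '' planeSec K b c := by
    ext x
    constructor
    · rintro ⟨hxK, hx⟩
      have hx0 : ⟪cross b c, x⟫_ℝ = 0 := hx
      have e : planeMap b c (⟪cross c a, x⟫_ℝ / D, ⟪cross a b, x⟫_ℝ / D) = x := by
        have h1 : D • x = ⟪cross b c, x⟫_ℝ • a + (⟪cross c a, x⟫_ℝ • b + ⟪cross a b, x⟫_ℝ • c) := by
          apply ext_E3 <;> simp only [hDdef, inner_E3, cross_zero, cross_one, cross_two,
            PiLp.add_apply, PiLp.smul_apply, smul_eq_mul] <;> ring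
        rw [hx0, zero_smul, zero_add] at h1
        have h2 : D • planeMap b c (⟪cross c a, x⟫_ℝ / D, ⟪cross a b, x⟫_ℝ / D) = D • x := by
          rw [h1, planeMap, smul_add, smul_smul, smul_smul, mul_div_cancel₀ _ hD,
            mul_div_cancel₀ _ hD]
        exact smul_right_injective E3 hD h2
      exact ⟨_, (congrArg (· ∈ K) e).mpr hxK, e⟩
    · rintro ⟨q, hq, rfl⟩
      exact ⟨hq, hbc q⟩
  obtain ⟨m, hm⟩ := hli.exists_hausdorffMeasure_image
  have : IsFiniteMeasure (volume.restrict (planeSec K b c)) :=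
    isFiniteMeasure_restrict.2 (volume_planeSec_lt_top hK hli).ne
  have hne := ae_restrict_of_ae (s := planeSec K b c) ae_ne_zero_prod
  have hq := measure_quadrant (measurePreserving_neg_planeSec hK b c)
    (f := fun q => D * q.1) (g := fun q => D * q.2) (by fun_prop) (by fun_prop)
    (fun q => by simp) (fun q => by simp)
    (hne.mono fun q hq => mul_ne_zero hD hq.1) (hne.mono fun q hq => mul_ne_zero hD hq.2)
    (by
      rw [← hs, secSign, integral_indicator (isClosed_planeSec hK b c).measurableSet]
      refine integral_congr_ae (.of_forall fun q => ?_)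
      simp only
      rw [mul_mul_mul_comm, sg_smul (mul_self_pos.2 hD)]) δ δ'
  rw [Measure.restrict_apply_univ, Measure.restrict_apply' (isClosed_planeSec hK b c).measurableSet,
    Set.inter_comm] at hq
  rw [himg, ← Set.image_inter_preimage, hm, hm, mul_div_assoc, ← hq]
  congr 3
  ext q
  simp only [Set.mem_preimage, Set.mem_ofPred_eq, hca, hab]

lemma volume_octant {u : Fin 3 → E3} (hu : ∀ i, u i ≠ 0) (h01 : volSign K (u 0) (u 1) = 0)
    (h02 : volSign K (u 0) (u 2) = 0) (h12 : volSign K (u 1) (u 2) = 0) (ε : Fin 3 → Bool) :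
    volume (K ∩ octant u ε) = volume K / 8 := by
  have : IsFiniteMeasure (volume.restrict K) := isFiniteMeasure_restrict.2 hK.volume_lt_top.ne
  have hne := fun i => ae_restrict_of_ae (s := K) (ae_inner_ne_zero (hu i))
  have h := measure_octant (measurePreserving_neg_body hK)
    (f := fun x => ⟪u 0, x⟫_ℝ) (g := fun x => ⟪u 1, x⟫_ℝ) (h := fun x => ⟪u 2, x⟫_ℝ)
    (by fun_prop) (by fun_prop) (by fun_prop) (fun x => inner_neg_right _ _)
    (fun x => inner_neg_right _ _) (fun x => inner_neg_right _ _) (hne 0) (hne 1) (hne 2)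
    h01 h02 h12 (ε 0) (ε 1) (ε 2)
  rw [Measure.restrict_apply_univ, Measure.restrict_apply' hK.measurableSet,
    Set.inter_comm] at h
  rw [← h]
  congr 2
  ext x
  simp only [octant, Set.mem_ofPred_eq, Fin.forall_fin_succ, Fin.isValue]
  simp [and_assoc]

end

/-- Equipartition theorem in `ℝ³`: for every centrally symmetric convex body `K` there are
three planes through the origin (with normals `u 0, u 1, u 2`) splitting `K` into 8 pieces
of equal volume, and such that for each `i` the section `K ∩ H_i` is split by the other two
planes into 4 parts of equal 2-dimensional (Hausdorff) area. -/
theorem equipartition_dim3 (K : Set (EuclideanSpace ℝ (Fin 3))) (hK : IsConvexBody K)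
    (hsym : K = -K) :
    ∃ u : Fin 3 → EuclideanSpace ℝ (Fin 3),
      (∀ i, u i ≠ 0) ∧
      (∀ ε : Fin 3 → Bool, volume (K ∩ octant u ε) = volume K / 8) ∧
      (∀ i : Fin 3, ∀ ε : Fin 3 → Bool,
        μH[(2 : ℝ)] (K ∩ {x | ⟪u i, x⟫_ℝ = 0} ∩
            {x | ∀ j, j ≠ i → (if ε j then 0 ≤ ⟪u j, x⟫_ℝ else ⟪u j, x⟫_ℝ ≤ 0)}) =
          μH[(2 : ℝ)] (K ∩ {x | ⟪u i, x⟫_ℝ = 0}) / 4) := by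
  have hS : SymBody K := ⟨hK, fun x hx => by
    rw [hsym] at hx
    exact hx⟩
  obtain ⟨n, P, Q, hD, hV, hA, hB⟩ := exists_defect_eq_zero hS
  have hP : LI P n := (LI.of_inner_cross hD).symm
  have hQ : LI Q n := LI.of_inner_cross (c := P) (by
    rwa [inner_cross_cyclic, inner_cross_cyclic])
  obtain ⟨p, hp⟩ : ∃ p, p = tilt K n P := ⟨_, rfl⟩
  obtain ⟨q, hq⟩ : ∃ q, q = tilt K n Q := ⟨_, rfl⟩
  have hB1 : volSign K (cross n P) (cross p q) = 0 := by rw [hp, hq]; exact congrArg Complex.re hB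
  have hB2 : volSign K (cross n Q) (cross p q) = 0 := by rw [hp, hq]; exact congrArg Complex.im hB
  have hnP : cross n p = cross n P := by rw [hp, tilt, cross_shear]
  have hnQ : cross n q = cross n Q := by rw [hq, tilt, cross_shear]
  have hD0 : ⟪cross p q, n⟫_ℝ ≠ 0 := by rwa [hp, hq, inner_cross_tilt]
  have hD1 : ⟪cross n p, q⟫_ℝ ≠ 0 := by rwa [← inner_cross_cyclic]
  have hD2 : ⟪cross q n, p⟫_ℝ ≠ 0 := by rwa [inner_cross_cyclic]
  have hpq : secSign K p q = 0 := by rw [hp, hq]; exact hA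
  have hqn : secSign K q n = 0 := by rw [hq]; exact secSign_secSlope hS hQ
  have hnp : secSign K n p = 0 := by rw [secSign_comm hS, hp]; exact secSign_secSlope hS hP
  have hne : ∀ {a b c : E3}, ⟪cross a b, c⟫_ℝ ≠ 0 → cross a b ≠ 0 := fun h h0 =>
    h (by rw [h0, inner_zero_left])
  refine ⟨![cross p q, cross q n, cross n p], ?_, ?_, ?_⟩
  · intro i
    fin_cases i
    exacts [hne hD0, hne hD2, hne hD1]
  · refine volume_octant hS (fun i => ?_) ?_ ?_ ?_
    · fin_cases i
      exacts [hne hD0, hne hD2, hne hD1]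
    · change volSign K (cross p q) (cross q n) = 0
      rw [cross_comm q n, volSign_neg_right, hnQ, volSign_comm, hB2, neg_zero]
    · change volSign K (cross p q) (cross n p) = 0
      rw [hnP, volSign_comm, hB1]
    · change volSign K (cross q n) (cross n p) = 0
      rw [cross_comm q n, volSign_neg_left, hnQ, hnP, volSign_comm, hV, neg_zero]
  · intro i ε
    fin_cases i
    · refine .trans (congrArg (fun s => μH[(2 : ℝ)] (K ∩ {x | ⟪cross p q, x⟫_ℝ = 0} ∩ s))
        (Set.ext fun x => ?_)) (hausdorffMeasure_section hS hD1 hpq (ε 1) (ε 2))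
      simp [Fin.forall_fin_succ]
    · refine .trans (congrArg (fun s => μH[(2 : ℝ)] (K ∩ {x | ⟪cross q n, x⟫_ℝ = 0} ∩ s))
        (Set.ext fun x => ?_)) (hausdorffMeasure_section hS hD0 hqn (ε 2) (ε 0))
      simp [Fin.forall_fin_succ, and_comm]
    · refine .trans (congrArg (fun s => μH[(2 : ℝ)] (K ∩ {x | ⟪cross n p, x⟫_ℝ = 0} ∩ s))
        (Set.ext fun x => ?_)) (hausdorffMeasure_section hS hD2 hnp (ε 0) (ε 1))
      simp [Fin.forall_fin_succ]
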